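/- arXiv:1406.5622 — 2 statements merged into one kernel-verified Lean document; each statement's English description precedes it below -/
import Mathlib

section
/- Under the interpolated gain-scheduling setup, suppose the rate condition sup_{t≥0}|ρ̇(t)| ≤ min_i { λ_min(Qᵢ) · [ sup_k ‖X_{i,ρᵏ⁺¹} − X_{i,ρᵏ}‖ / (ρ̄ᵏ − ρ̲ᵏ⁺¹) ]⁻¹ } holds. Then every solution of the parameter-varying closed-loop system with the interpolated protocol gains synchronizes asymptotically: for all disturbances w₀, wᵢ, wᵢⱼ ∈ L₂[0,∞), lim_{t→∞} Σ_{i=1}^N ‖x(t) − xᵢ(t)‖² = 0. -/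
open MeasureTheory Matrix Set Filter

noncomputable section

/-- Frobenius norm of a square real matrix (a fixed choice of matrix norm). -/
def frobNorm {n : ℕ} (M : Matrix (Fin n) (Fin n) ℝ) : ℝ :=
  Real.sqrt (∑ i, ∑ j, (M i j) ^ 2)

/-- A function `f : [0,∞) → ℝ^k` belongs to `L₂[0,∞)` (its squared Euclidean
norm is integrable on `[0,∞)`). -/
def IsL2 {k : ℕ} (f : ℝ → Fin k → ℝ) : Prop :=
  MeasureTheory.IntegrableOn (fun t => f t ⬝ᵥ f t) (Set.Ici 0) MeasureTheory.volume

/-- The data of the multi-agent network: the directed graph (given by the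
in-neighbourhood sets `V i`, with no self-loops), the coefficient matrices of the
reference system, the agents, the measurements and the communication channels, the
Lipschitz-bound matrix `R`, the performance weights `Q i`, and the constants
`γ` (`gam`) and `δ i`. -/
structure NetData (n l m r r0 N : ℕ) where
  V : Fin N → Finset (Fin N)
  B1 : Matrix (Fin n) (Fin l) ℝ
  B20 : Matrix (Fin n) (Fin r0) ℝ
  B2 : Fin N → Matrix (Fin n) (Fin r) ℝ
  C2 : Fin N → Matrix (Fin m) (Fin n) ℝ
  D2 : Fin N → Matrix (Fin m) (Fin r) ℝ
  H : Fin N → Fin N → Matrix (Fin m) (Fin n) ℝ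
  G : Fin N → Fin N → Matrix (Fin m) (Fin r) ℝ
  R : Matrix (Fin n) (Fin n) ℝ
  Q : Fin N → Matrix (Fin n) (Fin n) ℝ
  gam : ℝ
  δ : Fin N → ℝ

namespace NetData

variable {n l m r r0 N : ℕ} (d : NetData n l m r r0 N)

def E (i : Fin N) : Matrix (Fin m) (Fin m) ℝ := d.D2 i * (d.D2 i)ᵀ

def F (i j : Fin N) : Matrix (Fin m) (Fin m) ℝ := d.G i j * (d.G i j)ᵀ

/-- in-degree `p i` -/
def pdeg (i : Fin N) : ℕ := (d.V i).card

/-- out-degree `q i` -/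
def qdeg (i : Fin N) : ℕ := (Finset.univ.filter fun j => i ∈ d.V j).card

/-- Standing assumptions: no self-loops, `E₂ᵢ ≻ 0`, `Fᵢⱼ ≻ 0` on edges,
`R ⪰ 0`, `γ > 0`, `δᵢ > 0`, `Qᵢ ≻ 0`. -/
def Standing : Prop :=
  (∀ i, i ∉ d.V i) ∧ (∀ i, (d.E i).PosDef) ∧ (∀ i j, j ∈ d.V i → (d.F i j).PosDef)
    ∧ d.R.PosSemidef ∧ 0 < d.gam ∧ (∀ i, 0 < d.δ i) ∧ (∀ i, (d.Q i).PosDef)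

/-- The global Lipschitz condition (4) on the nonlinearity `φ`. -/
def LipOK (φ : (Fin n → ℝ) → Fin l → ℝ) : Prop :=
  ∀ a b : Fin n → ℝ, (φ a - φ b) ⬝ᵥ (φ a - φ b) ≤ (a - b) ⬝ᵥ (d.R *ᵥ (a - b))

def Acl (Aρ : Matrix (Fin n) (Fin n) ℝ) (i : Fin N) : Matrix (Fin n) (Fin n) ℝ :=
  Aρ + d.δ i • (1 : Matrix (Fin n) (Fin n) ℝ) + d.B2 i * (d.D2 i)ᵀ * (d.E i)⁻¹ * d.C2 i

/-- The matrix `Sᵢ(ρ)` of the coupled LMIs (12), evaluated at `A(ρ) = Aρ`. -/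
def Smat (Aρ : Matrix (Fin n) (Fin n) ℝ) (X : Fin N → Matrix (Fin n) (Fin n) ℝ)
    (i : Fin N) : Matrix (Fin n) (Fin n) ℝ :=
  X i * d.Acl Aρ i + (d.Acl Aρ i)ᵀ * X i
    + ((d.pdeg i + d.qdeg i : ℕ) : ℝ) • (1 : Matrix (Fin n) (Fin n) ℝ)
    - d.gam ^ 2 • ((d.C2 i)ᵀ * (d.E i)⁻¹ * d.C2 i)
    - d.gam ^ 2 • (∑ j ∈ d.V i, (d.H i j)ᵀ * (d.F i j)⁻¹ * d.H i j)
    + d.Q i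

/-- The quadratic form of the reduced coupled LMI (18):
`z ↦ zᵀ [[Sᵢ(ρ)+τᵢR, Tᵢ],[Tᵢᵀ, −Υᵢ]] z` for `z = (ξ, a, bv, c, (v j)_{j ∈ V i})`. -/
def redQF (Aρ : Matrix (Fin n) (Fin n) ℝ) (τ : Fin N → ℝ)
    (X : Fin N → Matrix (Fin n) (Fin n) ℝ) (i : Fin N)
    (ξ : Fin n → ℝ) (a : Fin r0 → ℝ) (bv : Fin r → ℝ) (c : Fin l → ℝ)
    (v : Fin N → Fin n → ℝ) : ℝ :=
  ξ ⬝ᵥ (d.Smat Aρ X i *ᵥ ξ) + τ i * (ξ ⬝ᵥ (d.R *ᵥ ξ))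
    + 2 * (ξ ⬝ᵥ ((X i * d.B20) *ᵥ a))
    + 2 * (ξ ⬝ᵥ ((X i * d.B2 i *
        ((1 : Matrix (Fin r) (Fin r) ℝ) - (d.D2 i)ᵀ * (d.E i)⁻¹ * d.D2 i)) *ᵥ bv))
    + 2 * (ξ ⬝ᵥ ((X i * d.B1) *ᵥ c))
    + 2 * ∑ j ∈ d.V i,
        ξ ⬝ᵥ ((d.gam ^ 2 • ((d.H i j)ᵀ * (d.F i j)⁻¹ * d.H i j)
          - (1 : Matrix (Fin n) (Fin n) ℝ)) *ᵥ v j)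
    - d.gam ^ 2 * (a ⬝ᵥ a) - d.gam ^ 2 * (bv ⬝ᵥ bv) - τ i * (c ⬝ᵥ c)
    - ∑ j ∈ d.V i, (2 * d.δ j / ((d.qdeg j : ℝ) + 1)) * (v j ⬝ᵥ (X j *ᵥ v j))

/-- The reduced coupled LMIs (18): negative definiteness of each block matrix,
expressed via its quadratic form. -/
def ReducedLMI (Aρ : Matrix (Fin n) (Fin n) ℝ) (τ : Fin N → ℝ)
    (X : Fin N → Matrix (Fin n) (Fin n) ℝ) : Prop :=
  ∀ (i : Fin N) (ξ : Fin n → ℝ) (a : Fin r0 → ℝ) (bv : Fin r → ℝ) (c : Fin l → ℝ)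
    (v : Fin N → Fin n → ℝ),
    ¬(ξ = 0 ∧ a = 0 ∧ bv = 0 ∧ c = 0 ∧ ∀ j ∈ d.V i, v j = 0) →
    d.redQF Aρ τ X i ξ a bv c v < 0

/-- The quadratic form of the full coupled LMI (12), for
`z = (ξ, a, bv, c, (v j)_{j ∈ V i}, zz)`. -/
def fullQF (Aρ : Matrix (Fin n) (Fin n) ℝ) (α : ℝ) (τ θ : Fin N → ℝ)
    (X : Fin N → Matrix (Fin n) (Fin n) ℝ) (i : Fin N)
    (ξ : Fin n → ℝ) (a : Fin r0 → ℝ) (bv : Fin r → ℝ) (c : Fin l → ℝ)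
    (v : Fin N → Fin n → ℝ) (zz : Fin n → ℝ) : ℝ :=
  d.redQF Aρ τ X i ξ a bv c v + θ i * α ^ 2 * (ξ ⬝ᵥ ξ)
    + 2 * (ξ ⬝ᵥ (X i *ᵥ zz)) - θ i * (zz ⬝ᵥ zz)

/-- The coupled LMIs (12) at the point `ρ` (with `A(ρ) = Aρ`) with uncertainty
size `α`: negative definiteness of each block matrix, via its quadratic form. -/
def CoupledLMI (Aρ : Matrix (Fin n) (Fin n) ℝ) (α : ℝ) (τ θ : Fin N → ℝ)
    (X : Fin N → Matrix (Fin n) (Fin n) ℝ) : Prop :=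
  ∀ (i : Fin N) (ξ : Fin n → ℝ) (a : Fin r0 → ℝ) (bv : Fin r → ℝ) (c : Fin l → ℝ)
    (v : Fin N → Fin n → ℝ) (zz : Fin n → ℝ),
    ¬(ξ = 0 ∧ a = 0 ∧ bv = 0 ∧ c = 0 ∧ (∀ j ∈ d.V i, v j = 0) ∧ zz = 0) →
    d.fullQF Aρ α τ θ X i ξ a bv c v zz < 0

/-- Feasibility of the coupled LMIs (12): positivity of scalar variables,
positive definiteness of the `Xᵢ` and the LMIs themselves. -/
def Feasible (Aρ : Matrix (Fin n) (Fin n) ℝ) (α : ℝ) (τ θ : Fin N → ℝ)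
    (X : Fin N → Matrix (Fin n) (Fin n) ℝ) : Prop :=
  (∀ i, 0 < τ i) ∧ (∀ i, 0 < θ i) ∧ (∀ i, (X i).PosDef) ∧ d.CoupledLMI Aρ α τ θ X

/-- Interconnection gains `Kᵢⱼ = γ²Xᵢ⁻¹HᵢⱼᵀFᵢⱼ⁻¹`. -/
def Kgain (X : Fin N → Matrix (Fin n) (Fin n) ℝ) (i j : Fin N) :
    Matrix (Fin n) (Fin m) ℝ :=
  d.gam ^ 2 • ((X i)⁻¹ * (d.H i j)ᵀ * (d.F i j)⁻¹)

/-- Observer gains `Lᵢ = (γ²Xᵢ⁻¹C₂ᵢᵀ − B₂ᵢD₂ᵢᵀ)E₂ᵢ⁻¹`. -/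
def Lgain (X : Fin N → Matrix (Fin n) (Fin n) ℝ) (i : Fin N) :
    Matrix (Fin n) (Fin m) ℝ :=
  (d.gam ^ 2 • ((X i)⁻¹ * (d.C2 i)ᵀ) - d.B2 i * (d.D2 i)ᵀ) * (d.E i)⁻¹

/-- `x, (xa i)` is a solution of the closed-loop system: the reference system (5)
(with the extra uncertainty `ψ`), the agents (6), the measurements (3), and the
protocol (8) with (possibly time-varying) gains `K t i j`, `L t i`. -/
def ClosedLoop (Aρ : ℝ → Matrix (Fin n) (Fin n) ℝ)
    (φ : (Fin n → ℝ) → Fin l → ℝ) (ψ : ℝ → (Fin n → ℝ) → Fin n → ℝ)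
    (K : ℝ → Fin N → Fin N → Matrix (Fin n) (Fin m) ℝ)
    (L : ℝ → Fin N → Matrix (Fin n) (Fin m) ℝ)
    (w0 : ℝ → Fin r0 → ℝ) (w : Fin N → ℝ → Fin r → ℝ)
    (wE : Fin N → Fin N → ℝ → Fin r → ℝ)
    (x : ℝ → Fin n → ℝ) (xa : Fin N → ℝ → Fin n → ℝ) : Prop :=
  (∀ t ∈ Ici (0:ℝ),
    HasDerivAt x (Aρ t *ᵥ x t + d.B1 *ᵥ φ (x t) + d.B20 *ᵥ w0 t + ψ t (x t)) t) ∧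
  ∀ i, ∀ t ∈ Ici (0:ℝ),
    HasDerivAt (xa i)
      (Aρ t *ᵥ xa i t + d.B1 *ᵥ φ (xa i t) + ψ t (xa i t)
        + (L t i *ᵥ ((d.C2 i *ᵥ x t + d.D2 i *ᵥ w i t) - d.C2 i *ᵥ xa i t)
          + ∑ j ∈ d.V i, K t i j *ᵥ ((d.H i j *ᵥ xa j t + d.G i j *ᵥ wE i j t)
              - d.H i j *ᵥ xa i t))
        + d.B2 i *ᵥ w i t) t

/-- The disagreement function `Ψ_G` (11). -/
def disagree (e : Fin N → Fin n → ℝ) : ℝ :=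
  (1 / (N : ℝ)) * ∑ i, ∑ j ∈ d.V i, (e j - e i) ⬝ᵥ (e j - e i)

/-- `‖(x₀,w₀,w,w̄)‖²` with `P = diag[(1/N)Xᵢ]`. -/
def distSq (X : Fin N → Matrix (Fin n) (Fin n) ℝ) (x0 : Fin n → ℝ)
    (x0a : Fin N → Fin n → ℝ) (w0 : ℝ → Fin r0 → ℝ) (w : Fin N → ℝ → Fin r → ℝ)
    (wE : Fin N → Fin N → ℝ → Fin r → ℝ) : ℝ :=
  (1 / (N : ℝ)) * ∑ i, (x0 - x0a i) ⬝ᵥ (X i *ᵥ (x0 - x0a i))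
    + (∫ t in Ici (0:ℝ), w0 t ⬝ᵥ w0 t)
    + (1 / (N : ℝ)) * ∑ i, ((∫ t in Ici (0:ℝ), w i t ⬝ᵥ w i t)
        + ∑ j ∈ d.V i, ∫ t in Ici (0:ℝ), wE i j t ⬝ᵥ wE i j t)

end NetData

/-! ### Quadratic forms -/

theorem dotProduct_transpose_mulVec' {p q : ℕ} (M : Matrix (Fin p) (Fin q) ℝ)
    (x : Fin q → ℝ) (y : Fin p → ℝ) : x ⬝ᵥ (Mᵀ *ᵥ y) = (M *ᵥ x) ⬝ᵥ y := by
  rw [Matrix.dotProduct_mulVec, Matrix.vecMul_transpose]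

theorem dotProduct_mulVec_comm_of_posDef {p : ℕ} {M : Matrix (Fin p) (Fin p) ℝ}
    (hM : M.PosDef) (x y : Fin p → ℝ) : x ⬝ᵥ (M *ᵥ y) = y ⬝ᵥ (M *ᵥ x) := by
  have h : Mᵀ = M := by simpa using hM.isHermitian.eq
  rw [dotProduct_comm, ← dotProduct_transpose_mulVec', h]

theorem posDef_dotProduct_mulVec_nonneg {p : ℕ} {M : Matrix (Fin p) (Fin p) ℝ}
    (hM : M.PosDef) (x : Fin p → ℝ) : 0 ≤ x ⬝ᵥ (M *ᵥ x) := by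
  simpa using hM.posSemidef.dotProduct_mulVec_nonneg x

theorem dotProduct_self_nonneg' {p : ℕ} (x : Fin p → ℝ) : 0 ≤ x ⬝ᵥ x := by
  simpa using dotProduct_star_self_nonneg x

theorem abs_dotProduct_mulVec_le_frobNorm {p : ℕ} (M : Matrix (Fin p) (Fin p) ℝ)
    (x : Fin p → ℝ) : |x ⬝ᵥ (M *ᵥ x)| ≤ frobNorm M * (x ⬝ᵥ x) := by
  have hx := dotProduct_self_nonneg' x
  have hF : 0 ≤ frobNorm M := Real.sqrt_nonneg _
  have hsq : frobNorm M ^ 2 = ∑ i, ∑ j, (M i j) ^ 2 :=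
    Real.sq_sqrt (Finset.sum_nonneg fun _ _ => Finset.sum_nonneg fun _ _ => sq_nonneg _)
  refine abs_le_of_sq_le_sq ?_ (mul_nonneg hF hx)
  have h := Finset.sum_mul_sq_le_sq_mul_sq (Finset.univ : Finset (Fin p × Fin p))
    (fun z => M z.1 z.2) (fun z => x z.1 * x z.2)
  rw [Fintype.sum_prod_type, Fintype.sum_prod_type, Fintype.sum_prod_type] at h
  have h1 : x ⬝ᵥ (M *ᵥ x) = ∑ i, ∑ j, M i j * (x i * x j) := by
    simp only [dotProduct, Matrix.mulVec, Finset.mul_sum]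
    exact Finset.sum_congr rfl fun i _ => Finset.sum_congr rfl fun j _ => by ring
  have h2 : (x ⬝ᵥ x) ^ 2 = ∑ i, ∑ j, (x i * x j) ^ 2 := by
    simp only [dotProduct, sq, Finset.sum_mul_sum]
    exact Finset.sum_congr rfl fun i _ => Finset.sum_congr rfl fun j _ => by ring
  rw [mul_pow, hsq, h1, h2]
  exact h

theorem exists_pos_mul_dotProduct_le_of_posDef {p : ℕ} {M : Matrix (Fin p) (Fin p) ℝ}
    (hM : M.PosDef) : ∃ c > 0, ∀ x : Fin p → ℝ, c * (x ⬝ᵥ x) ≤ x ⬝ᵥ (M *ᵥ x) := by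
  set S : Set (Fin p → ℝ) := {x | x ⬝ᵥ x = 1} with hS
  have hcl : IsClosed S := isClosed_eq (by fun_prop) continuous_const
  have hb : Bornology.IsBounded S := by
    refine (Metric.isBounded_closedBall (x := (0 : Fin p → ℝ)) (r := 1)).subset ?_
    intro x hx
    rw [mem_closedBall_zero_iff, pi_norm_le_iff_of_nonneg zero_le_one]
    intro i
    have h1 : x i * x i ≤ x ⬝ᵥ x :=
      Finset.single_le_sum (f := fun j => x j * x j) (fun j _ => mul_self_nonneg _)
        (Finset.mem_univ i)
    rw [Real.norm_eq_abs, ← sq_le_one_iff_abs_le_one, sq]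
    exact h1.trans_eq hx
  have hK : IsCompact S := Metric.isCompact_of_isClosed_isBounded hcl hb
  have hcont : Continuous fun x : Fin p → ℝ => x ⬝ᵥ (M *ᵥ x) := by fun_prop
  obtain ⟨c, hc, hcS⟩ : ∃ c > 0, ∀ x ∈ S, c ≤ x ⬝ᵥ (M *ᵥ x) := by
    rcases S.eq_empty_or_nonempty with he | hne
    · exact ⟨1, one_pos, by simp [he]⟩
    · obtain ⟨y, hy, hmin⟩ := hK.exists_isMinOn hne hcont.continuousOn
      refine ⟨y ⬝ᵥ (M *ᵥ y), ?_, fun x hx => hmin hx⟩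
      have hy0 : y ≠ 0 := by
        rintro rfl
        simp [hS] at hy
      simpa using hM.dotProduct_mulVec_pos hy0
  refine ⟨c, hc, fun x => ?_⟩
  rcases (dotProduct_self_nonneg' x).eq_or_lt with h0 | hpos
  · rw [← h0, mul_zero]
    exact posDef_dotProduct_mulVec_nonneg hM x
  · set s := Real.sqrt (x ⬝ᵥ x)
    have hs : 0 < s := Real.sqrt_pos.2 hpos
    have hss : x ⬝ᵥ x = s * s := (Real.mul_self_sqrt hpos.le).symm
    have h := hcS (s⁻¹ • x) (by
      simp only [hS, Set.mem_ofPred_eq, smul_dotProduct, dotProduct_smul, smul_eq_mul, hss]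
      field_simp)
    simp only [Matrix.mulVec_smul, smul_dotProduct, dotProduct_smul, smul_eq_mul] at h
    rw [hss]
    calc c * (s * s) ≤ (s⁻¹ * (s⁻¹ * x ⬝ᵥ (M *ᵥ x))) * (s * s) := by gcongr
      _ = _ := by field_simp

/-! ### One-sided derivatives of saturated functions -/

theorem exists_hasDerivWithinAt_max_zero {f : ℝ → ℝ} {f' t : ℝ} (hf : HasDerivAt f f' t) :
    ∃ p : ℝ, (p = 0 ∨ p = 1) ∧ (f t < 0 → p = 0) ∧ (0 < f t → p = 1) ∧
      HasDerivWithinAt (fun z => max 0 (f z)) (p * f') (Ioi t) t := by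
  have hslope := (hasDerivWithinAt_iff_tendsto_slope' (self_notMem_Ioi)).1
    (hf.hasDerivWithinAt (s := Ioi t))
  have hpos : ∀ z ∈ Ioi t, f t = 0 → 0 < slope f t z → 0 < f z := by
    intro z hz h0 h
    rw [slope_def_field, h0, sub_zero] at h
    exact (div_pos_iff_of_pos_right (sub_pos.2 hz)).1 h
  have hneg : ∀ z ∈ Ioi t, f t = 0 → slope f t z < 0 → f z < 0 := by
    intro z hz h0 h
    rw [slope_def_field, h0, sub_zero] at h
    by_contra hc
    exact absurd (div_nonneg (not_lt.1 hc) (sub_pos.2 hz).le) (not_le.2 h)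
  have hzero : (∀ᶠ z in nhdsWithin t (Ioi t), f z < 0) → f t ≤ 0 →
      HasDerivWithinAt (fun z => max 0 (f z)) (0 * f') (Ioi t) t := by
    intro h h0
    rw [zero_mul]
    refine (hasDerivWithinAt_const t (Ioi t) (0 : ℝ)).congr_of_eventuallyEq ?_ (max_eq_left h0)
    filter_upwards [h] with z hz using max_eq_left hz.le
  have hone : (∀ᶠ z in nhdsWithin t (Ioi t), 0 < f z) → 0 ≤ f t →
      HasDerivWithinAt (fun z => max 0 (f z)) (1 * f') (Ioi t) t := by
    intro h h0
    rw [one_mul]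
    refine hf.hasDerivWithinAt.congr_of_eventuallyEq ?_ (max_eq_right h0)
    filter_upwards [h] with z hz using max_eq_right hz.le
  rcases lt_trichotomy (f t) 0 with h | h | h
  · exact ⟨0, .inl rfl, fun _ => rfl, fun h' => absurd h' h.not_gt,
      hzero (nhdsWithin_le_nhds (hf.continuousAt.eventually_lt_const h)) h.le⟩
  · rcases lt_trichotomy f' 0 with h' | h' | h'
    · refine ⟨0, .inl rfl, fun _ => rfl, fun h'' => absurd h h''.ne', hzero ?_ h.le⟩
      filter_upwards [hslope.eventually_lt_const h', self_mem_nhdsWithin] with z hz hzt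
        using hneg z hzt h hz
    · subst h'
      refine ⟨0, .inl rfl, fun _ => rfl, fun h'' => absurd h h''.ne', ?_⟩
      rw [hasDerivWithinAt_iff_isLittleO]
      have hlit := hasDerivWithinAt_iff_isLittleO.1 (hf.hasDerivWithinAt (s := Ioi t))
      refine Asymptotics.IsBigO.trans_isLittleO (Asymptotics.IsBigO.of_bound 1 ?_) hlit
      refine Eventually.of_forall fun z => ?_
      simp only [h, max_self, mul_zero, smul_eq_mul, sub_zero, one_mul, Real.norm_eq_abs]
      rw [abs_of_nonneg (le_max_left _ _)]
      exact max_le (abs_nonneg _) (le_abs_self _)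
    · refine ⟨1, .inr rfl, fun h'' => absurd h h''.ne, fun _ => rfl, hone ?_ h.ge⟩
      filter_upwards [hslope.eventually_const_lt h', self_mem_nhdsWithin] with z hz hzt
        using hpos z hzt h hz
  · exact ⟨1, .inr rfl, fun h' => absurd h' h.not_gt, fun _ => rfl,
      hone (nhdsWithin_le_nhds (hf.continuousAt.eventually_const_lt h)) h.le⟩

/-- The ramp from `0` to `1` across the interval `[u, b]`. -/
def ramp (u b s : ℝ) : ℝ := max 0 ((s - u) / (b - u)) - max 0 ((s - u) / (b - u) - 1)

theorem ramp_of_le {u b s : ℝ} (hub : u < b) (hs : s ≤ u) : ramp u b s = 0 := by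
  have h : (s - u) / (b - u) ≤ 0 := div_nonpos_of_nonpos_of_nonneg (by linarith) (by linarith)
  rw [ramp, max_eq_left h, max_eq_left (by linarith), sub_zero]

theorem ramp_of_ge {u b s : ℝ} (hub : u < b) (hs : b ≤ s) : ramp u b s = 1 := by
  have h : 1 ≤ (s - u) / (b - u) := (one_le_div (by linarith)).2 (by linarith)
  rw [ramp, max_eq_right (by linarith), max_eq_right (by linarith)]
  ring

theorem ramp_of_mem {u b s : ℝ} (hub : u < b) (hs : s ∈ Icc u b) :
    ramp u b s = (s - u) / (b - u) := by
  have h0 : 0 ≤ (s - u) / (b - u) := div_nonneg (by linarith [hs.1]) (by linarith)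
  have h1 : (s - u) / (b - u) ≤ 1 := (div_le_one (by linarith)).2 (by linarith [hs.2])
  rw [ramp, max_eq_right h0, max_eq_left (by linarith), sub_zero]

theorem continuous_ramp (u b : ℝ) : Continuous (ramp u b) := by
  unfold ramp
  fun_prop

theorem exists_hasDerivWithinAt_ramp {u b : ℝ} (hub : u < b) {ρ : ℝ → ℝ} {ρ' t : ℝ}
    (hρ : HasDerivAt ρ ρ' t) :
    ∃ p : ℝ, 0 ≤ p ∧ p ≤ 1 ∧ (ρ t ∉ Icc u b → p = 0) ∧
      HasDerivWithinAt (fun z => ramp u b (ρ z)) (p * (ρ' / (b - u))) (Ioi t) t := by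
  have hbu : 0 < b - u := sub_pos.2 hub
  have hf : HasDerivAt (fun z => (ρ z - u) / (b - u)) (ρ' / (b - u)) t :=
    (hρ.sub_const u).div_const _
  obtain ⟨p, hp, hpn, hpp, hpd⟩ := exists_hasDerivWithinAt_max_zero hf
  obtain ⟨q, hq, hqn, hqp, hqd⟩ := exists_hasDerivWithinAt_max_zero (hf.sub_const 1)
  have hle : q ≤ p := by
    rcases hq with rfl | rfl
    · rcases hp with rfl | rfl <;> norm_num
    · have h1 : 0 ≤ (ρ t - u) / (b - u) - 1 := by
        by_contra h
        exact zero_ne_one (hqn (not_le.1 h)).symm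
      exact (hpp (by linarith)).ge
  refine ⟨p - q, sub_nonneg.2 hle, ?_, fun hn => ?_, ?_⟩
  · rcases hp with rfl | rfl <;> rcases hq with rfl | rfl <;> norm_num
  · rw [Set.mem_Icc, not_and_or, not_le, not_le] at hn
    rcases hn with hn | hn
    · have h : (ρ t - u) / (b - u) < 0 := div_neg_of_neg_of_pos (by linarith) hbu
      rw [hpn h, hqn (by linarith), sub_zero]
    · have h : 1 < (ρ t - u) / (b - u) := (one_lt_div hbu).2 (by linarith)
      rw [hpp (by linarith), hqp (by linarith), sub_self]
  · rw [sub_mul]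
    exact hpd.sub hqd

/-! ### A comparison principle -/

theorem tendsto_zero_of_hasDerivWithinAt_le {V V' h : ℝ → ℝ} {ε : ℝ} (hε : 0 < ε)
    (hV0 : ∀ t ∈ Ici (0 : ℝ), 0 ≤ V t) (hVc : ContinuousOn V (Ici 0))
    (hVd : ∀ t ∈ Ici (0 : ℝ), HasDerivWithinAt V (V' t) (Ioi t) t)
    (hle : ∀ t ∈ Ici (0 : ℝ), V' t ≤ -ε * V t + h t)
    (hh0 : ∀ t, 0 ≤ h t) (hh : IntegrableOn h (Ici 0)) :
    Tendsto V atTop (nhds 0) := by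
  have hInt : ∀ s t, 0 ≤ s → IntegrableOn h (Icc s t) := fun s t hs =>
    hh.mono_set fun z hz => hs.trans hz.1
  have key : ∀ s t, 0 ≤ s → s ≤ t →
      V t ≤ Real.exp (-ε * (t - s)) * V s + ∫ z in s..t, h z := by
    intro s t hs hst
    have hexp : ∀ z, HasDerivAt (fun z => Real.exp (ε * (z - t))) (Real.exp (ε * (z - t)) * ε) z := by
      intro z
      simpa using ((((hasDerivAt_id z).sub_const t).const_mul ε).exp)
    have h1 := intervalIntegral.sub_le_integral_of_hasDeriv_right_of_le
      (g := fun z => Real.exp (ε * (z - t)) * V z)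
      (g' := fun z => Real.exp (ε * (z - t)) * ε * V z + Real.exp (ε * (z - t)) * V' z)
      (φ := h) hst
      ((by fun_prop : Continuous fun z => Real.exp (ε * (z - t))).continuousOn.mul
        (hVc.mono fun z hz => hs.trans hz.1))
      (fun z hz => (hexp z).hasDerivWithinAt.mul (hVd z (hs.trans hz.1.le)))
      (hInt s t hs)
      (fun z hz => by
        have hz0 : z ∈ Ici (0 : ℝ) := hs.trans hz.1.le
        have he : Real.exp (ε * (z - t)) ≤ 1 :=
          Real.exp_le_one_iff.2 (mul_nonpos_of_nonneg_of_nonpos hε.le (by linarith [hz.2]))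
        have hp := Real.exp_pos (ε * (z - t))
        have h2 := mul_le_mul_of_nonneg_left (hle z hz0) hp.le
        have h3 := mul_le_mul_of_nonneg_right he (hh0 z)
        linarith)
    simp only [sub_self, mul_zero, Real.exp_zero, one_mul] at h1
    have h2 : -ε * (t - s) = ε * (s - t) := by ring
    rw [h2]
    linarith
  have hlim := intervalIntegral_tendsto_integral_Ioi 0 (hh.mono_set Ioi_subset_Ici_self) tendsto_id
  rw [Metric.tendsto_atTop]
  intro η hη
  set I := ∫ z in Ioi (0 : ℝ), h z
  obtain ⟨s, hs⟩ := ((hlim.eventually_const_lt (show I - η / 2 < I by linarith)).and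
    (eventually_ge_atTop 0)).exists
  have hle_I : ∀ t, 0 ≤ t → ∫ z in (0 : ℝ)..t, h z ≤ I := by
    intro t ht
    rw [intervalIntegral.integral_of_le ht]
    exact setIntegral_mono_set (hh.mono_set Ioi_subset_Ici_self)
      (Eventually.of_forall hh0) (Eventually.of_forall Ioc_subset_Ioi_self)
  have hexp0 : Tendsto (fun t => Real.exp (-ε * (t - s)) * V s) atTop (nhds (0 * V s)) := by
    refine Tendsto.mul_const _ (Real.tendsto_exp_atBot.comp ?_)
    exact (tendsto_atTop_add_const_right _ (-s) tendsto_id).const_mul_atTop_of_neg (by linarith)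
  rw [zero_mul] at hexp0
  obtain ⟨T, hT⟩ := eventually_atTop.1 ((hexp0.eventually_lt_const (half_pos hη)).and
    (eventually_ge_atTop s))
  refine ⟨T, fun t ht => ?_⟩
  obtain ⟨h1, h2⟩ := hT t ht
  have ht0 : 0 ≤ t := hs.2.trans h2
  have h3 := key s t hs.2 h2
  have hii : ∀ a c, 0 ≤ a → a ≤ c → IntervalIntegrable h volume a c := fun a c ha hac =>
    (intervalIntegrable_iff_integrableOn_Icc_of_le hac).2 (hInt a c ha)
  have h4 := intervalIntegral.integral_add_adjacent_intervals (hii 0 s le_rfl hs.2) (hii s t hs.2 h2)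
  have h5 := hle_I t ht0
  have h6 := hs.1
  simp only [id] at h6
  rw [Real.dist_eq, sub_zero, abs_of_nonneg (hV0 t ht0)]
  linarith

/-! ### Consequences of the coupled LMIs -/

namespace NetData

variable {n l m r r0 N : ℕ} (d : NetData n l m r r0 N)

theorem fullQF_nonpos {A : Matrix (Fin n) (Fin n) ℝ} {α : ℝ} {τ θ : Fin N → ℝ}
    {X : Fin N → Matrix (Fin n) (Fin n) ℝ} (h : d.CoupledLMI A α τ θ X) (i : Fin N)
    (ξ : Fin n → ℝ) (a : Fin r0 → ℝ) (bv : Fin r → ℝ) (c : Fin l → ℝ)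
    (v : Fin N → Fin n → ℝ) (zz : Fin n → ℝ) : d.fullQF A α τ θ X i ξ a bv c v zz ≤ 0 := by
  by_cases h0 : ξ = 0 ∧ a = 0 ∧ bv = 0 ∧ c = 0 ∧ (∀ j ∈ d.V i, v j = 0) ∧ zz = 0
  · obtain ⟨rfl, rfl, rfl, rfl, hv, rfl⟩ := h0
    have hs : ∑ j ∈ d.V i, (2 * d.δ j / ((d.qdeg j : ℝ) + 1)) * (v j ⬝ᵥ (X j *ᵥ v j)) = 0 :=
      Finset.sum_eq_zero fun j hj => by simp [hv j hj]
    simp [fullQF, redQF, hs]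
  · exact (h i ξ a bv c v zz h0).le

theorem dotProduct_Smat_mulVec {X : Fin N → Matrix (Fin n) (Fin n) ℝ} {i : Fin N}
    (hX : (X i).PosDef) (A : Matrix (Fin n) (Fin n) ℝ) (ξ : Fin n → ℝ) :
    ξ ⬝ᵥ (d.Smat A X i *ᵥ ξ) =
      2 * (ξ ⬝ᵥ (X i *ᵥ (A *ᵥ ξ))) + 2 * d.δ i * (ξ ⬝ᵥ (X i *ᵥ ξ))
      + 2 * (ξ ⬝ᵥ (X i *ᵥ (d.B2 i *ᵥ ((d.D2 i)ᵀ *ᵥ ((d.E i)⁻¹ *ᵥ (d.C2 i *ᵥ ξ))))))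
      + ((d.pdeg i + d.qdeg i : ℕ) : ℝ) * (ξ ⬝ᵥ ξ)
      - d.gam ^ 2 * ((d.C2 i *ᵥ ξ) ⬝ᵥ ((d.E i)⁻¹ *ᵥ (d.C2 i *ᵥ ξ)))
      - d.gam ^ 2 * (∑ j ∈ d.V i, (d.H i j *ᵥ ξ) ⬝ᵥ ((d.F i j)⁻¹ *ᵥ (d.H i j *ᵥ ξ)))
      + ξ ⬝ᵥ (d.Q i *ᵥ ξ) := by
  have h1 : ξ ⬝ᵥ (X i *ᵥ (d.Acl A i *ᵥ ξ)) = ξ ⬝ᵥ (X i *ᵥ (A *ᵥ ξ)) + d.δ i * (ξ ⬝ᵥ (X i *ᵥ ξ))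
      + ξ ⬝ᵥ (X i *ᵥ (d.B2 i *ᵥ ((d.D2 i)ᵀ *ᵥ ((d.E i)⁻¹ *ᵥ (d.C2 i *ᵥ ξ))))) := by
    simp only [Acl, ← Matrix.mulVec_mulVec, Matrix.add_mulVec, Matrix.smul_mulVec,
      Matrix.one_mulVec, Matrix.mulVec_add, Matrix.mulVec_smul, dotProduct_add, dotProduct_smul,
      smul_eq_mul]
  have h2 : (d.Acl A i *ᵥ ξ) ⬝ᵥ (X i *ᵥ ξ) = ξ ⬝ᵥ (X i *ᵥ (d.Acl A i *ᵥ ξ)) :=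
    dotProduct_mulVec_comm_of_posDef hX _ _
  rw [Smat]
  simp only [Matrix.add_mulVec, Matrix.sub_mulVec, dotProduct_add, dotProduct_sub, h2, h1,
    Matrix.smul_mulVec, Matrix.sum_mulVec, Matrix.one_mulVec, dotProduct_smul, dotProduct_sum,
    ← Matrix.mulVec_mulVec, dotProduct_transpose_mulVec', smul_eq_mul]
  ring

theorem redQF_nonpos {A A₀ : Matrix (Fin n) (Fin n) ℝ} {α : ℝ} {τ θ : Fin N → ℝ}
    {X : Fin N → Matrix (Fin n) (Fin n) ℝ} (hf : d.Feasible A₀ α τ θ X)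
    (hA : (α ^ 2 • (1 : Matrix (Fin n) (Fin n) ℝ) - (A - A₀)ᵀ * (A - A₀)).PosSemidef)
    (i : Fin N) (ξ : Fin n → ℝ) (a : Fin r0 → ℝ) (bv : Fin r → ℝ) (c : Fin l → ℝ)
    (v : Fin N → Fin n → ℝ) : d.redQF A τ X i ξ a bv c v ≤ 0 := by
  obtain ⟨-, hθ, hX, hL⟩ := hf
  have h := d.fullQF_nonpos hL i ξ a bv c v ((A - A₀) *ᵥ ξ)
  have h2 : 0 ≤ α ^ 2 * (ξ ⬝ᵥ ξ) - ((A - A₀) *ᵥ ξ) ⬝ᵥ ((A - A₀) *ᵥ ξ) := by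
    have h3 := hA.dotProduct_mulVec_nonneg ξ
    simpa only [star_trivial, Matrix.sub_mulVec (α ^ 2 • 1), Matrix.smul_mulVec,
      Matrix.one_mulVec, dotProduct_sub, dotProduct_smul, smul_eq_mul, ← Matrix.mulVec_mulVec,
      dotProduct_transpose_mulVec'] using h3
  have h4 := mul_nonneg (hθ i).le h2
  have h5 : ξ ⬝ᵥ (X i *ᵥ ((A - A₀) *ᵥ ξ))
      = ξ ⬝ᵥ (X i *ᵥ (A *ᵥ ξ)) - ξ ⬝ᵥ (X i *ᵥ (A₀ *ᵥ ξ)) := by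
    rw [Matrix.sub_mulVec, Matrix.mulVec_sub, dotProduct_sub]
  simp only [fullQF, redQF, d.dotProduct_Smat_mulVec (hX i)] at h ⊢
  linarith

theorem redQF_combination {A : Matrix (Fin n) (Fin n) ℝ} {τ τ' : Fin N → ℝ}
    {X X' : Fin N → Matrix (Fin n) (Fin n) ℝ} {p q : ℝ} (hpq : p + q = 1)
    (hX : ∀ i, (X i).PosDef) (hX' : ∀ i, (X' i).PosDef)
    (hXX : ∀ i, (p • X i + q • X' i).PosDef)
    (i : Fin N) (ξ : Fin n → ℝ) (a : Fin r0 → ℝ) (bv : Fin r → ℝ) (c : Fin l → ℝ)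
    (v : Fin N → Fin n → ℝ) :
    d.redQF A (fun i => p * τ i + q * τ' i) (fun i => p • X i + q • X' i) i ξ a bv c v
      = p * d.redQF A τ X i ξ a bv c v + q * d.redQF A τ' X' i ξ a bv c v := by
  have hs : ∑ j ∈ d.V i, (2 * d.δ j / ((d.qdeg j : ℝ) + 1))
        * (v j ⬝ᵥ ((p • X j + q • X' j) *ᵥ v j))
      = p * (∑ j ∈ d.V i, (2 * d.δ j / ((d.qdeg j : ℝ) + 1)) * (v j ⬝ᵥ (X j *ᵥ v j)))
        + q * (∑ j ∈ d.V i, (2 * d.δ j / ((d.qdeg j : ℝ) + 1)) * (v j ⬝ᵥ (X' j *ᵥ v j))) := by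
    rw [Finset.mul_sum, Finset.mul_sum, ← Finset.sum_add_distrib]
    refine Finset.sum_congr rfl fun j _ => ?_
    simp only [Matrix.add_mulVec, Matrix.smul_mulVec, dotProduct_add, dotProduct_smul, smul_eq_mul]
    ring
  obtain rfl : q = 1 - p := by linarith
  simp only [redQF, d.dotProduct_Smat_mulVec (X := fun i => p • X i + (1 - p) • X' i) (hXX i),
    d.dotProduct_Smat_mulVec (hX i), d.dotProduct_Smat_mulVec (hX' i), hs]
  simp only [← Matrix.mulVec_mulVec, Matrix.add_mulVec, Matrix.smul_mulVec, dotProduct_add,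
    dotProduct_smul, smul_eq_mul]
  ring

/-- The right-hand side of the synchronization error dynamics at a node. -/
def errorField (A : Matrix (Fin n) (Fin n) ℝ) (X : Fin N → Matrix (Fin n) (Fin n) ℝ) (i : Fin N)
    (e : Fin N → Fin n → ℝ) (a : Fin r0 → ℝ) (c : Fin l → ℝ) (ω : Fin r → ℝ)
    (ωE : Fin N → Fin r → ℝ) : Fin n → ℝ :=
  A *ᵥ e i + d.B1 *ᵥ c + d.B20 *ᵥ a
    - (d.Lgain X i *ᵥ (d.C2 i *ᵥ e i + d.D2 i *ᵥ ω)
      + ∑ j ∈ d.V i, d.Kgain X i j *ᵥ (d.H i j *ᵥ (e i - e j) + d.G i j *ᵥ ωE j))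
    - d.B2 i *ᵥ ω

theorem mulVec_Lgain_mulVec {X : Fin N → Matrix (Fin n) (Fin n) ℝ} {i : Fin N}
    (hX : (X i).PosDef) (ξ : Fin n → ℝ) (z : Fin m → ℝ) :
    ξ ⬝ᵥ (X i *ᵥ (d.Lgain X i *ᵥ z)) = d.gam ^ 2 * ((d.C2 i *ᵥ ξ) ⬝ᵥ ((d.E i)⁻¹ *ᵥ z))
      - ξ ⬝ᵥ (X i *ᵥ (d.B2 i *ᵥ ((d.D2 i)ᵀ *ᵥ ((d.E i)⁻¹ *ᵥ z)))) := by
  have hdet : IsUnit (X i).det := (Matrix.isUnit_iff_isUnit_det _).1 hX.isUnit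
  have h : ∀ y, X i *ᵥ ((X i)⁻¹ *ᵥ y) = y := fun y => by
    rw [Matrix.mulVec_mulVec, Matrix.mul_nonsing_inv _ hdet, Matrix.one_mulVec]
  simp only [Lgain, ← Matrix.mulVec_mulVec, Matrix.sub_mulVec, Matrix.smul_mulVec,
    Matrix.mulVec_sub, Matrix.mulVec_smul, dotProduct_sub, dotProduct_smul, smul_eq_mul, h,
    dotProduct_transpose_mulVec']

theorem mulVec_Kgain_mulVec {X : Fin N → Matrix (Fin n) (Fin n) ℝ} {i : Fin N}
    (hX : (X i).PosDef) (j : Fin N) (ξ : Fin n → ℝ) (z : Fin m → ℝ) :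
    ξ ⬝ᵥ (X i *ᵥ (d.Kgain X i j *ᵥ z)) = d.gam ^ 2 * ((d.H i j *ᵥ ξ) ⬝ᵥ ((d.F i j)⁻¹ *ᵥ z)) := by
  have hdet : IsUnit (X i).det := (Matrix.isUnit_iff_isUnit_det _).1 hX.isUnit
  have h : ∀ y, X i *ᵥ ((X i)⁻¹ *ᵥ y) = y := fun y => by
    rw [Matrix.mulVec_mulVec, Matrix.mul_nonsing_inv _ hdet, Matrix.one_mulVec]
  simp only [Kgain, ← Matrix.mulVec_mulVec, Matrix.smul_mulVec,
    Matrix.mulVec_smul, dotProduct_smul, smul_eq_mul, h, dotProduct_transpose_mulVec']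

/-- Weighted disturbance power entering the dissipation inequality at a node. -/
def supply (i : Fin N) (a : Fin r0 → ℝ) (ω : Fin r → ℝ) (ωE : Fin N → Fin r → ℝ) : ℝ :=
  d.gam ^ 2 * (a ⬝ᵥ a)
    + d.gam ^ 2 * (1 + frobNorm ((d.D2 i)ᵀ * (d.E i)⁻¹ * d.D2 i)) * (ω ⬝ᵥ ω)
    + ∑ j ∈ d.V i,
      d.gam ^ 2 * frobNorm ((d.G i j)ᵀ * (d.F i j)⁻¹ * d.G i j) * (ωE j ⬝ᵥ ωE j)

theorem neg_two_mul_cross_le {p q k : ℕ} {M : Matrix (Fin p) (Fin p) ℝ} (hM : M.PosDef)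
    (D : Matrix (Fin p) (Fin k) ℝ) (C : Matrix (Fin p) (Fin q) ℝ) (ξ : Fin q → ℝ)
    (ω : Fin k → ℝ) :
    -2 * ((C *ᵥ ξ) ⬝ᵥ (M⁻¹ *ᵥ (D *ᵥ ω))) - (C *ᵥ ξ) ⬝ᵥ (M⁻¹ *ᵥ (C *ᵥ ξ))
      ≤ frobNorm (Dᵀ * M⁻¹ * D) * (ω ⬝ᵥ ω) := by
  have h1 := posDef_dotProduct_mulVec_nonneg hM.inv (C *ᵥ ξ + D *ᵥ ω)
  have h2 := (le_abs_self _).trans (abs_dotProduct_mulVec_le_frobNorm (Dᵀ * M⁻¹ * D) ω)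
  simp only [← Matrix.mulVec_mulVec, dotProduct_transpose_mulVec'] at h2
  simp only [Matrix.mulVec_add, dotProduct_add, add_dotProduct] at h1
  rw [dotProduct_mulVec_comm_of_posDef hM.inv (D *ᵥ ω) (C *ᵥ ξ)] at h1
  linarith

theorem node_dissipation (hstand : d.Standing) {A : Matrix (Fin n) (Fin n) ℝ} {τ : Fin N → ℝ}
    {X : Fin N → Matrix (Fin n) (Fin n) ℝ} {i : Fin N} (hX : (X i).PosDef) (hτ : 0 ≤ τ i)
    (e : Fin N → Fin n → ℝ) (a : Fin r0 → ℝ) (c : Fin l → ℝ) (ω : Fin r → ℝ)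
    (ωE : Fin N → Fin r → ℝ) (hc : c ⬝ᵥ c ≤ e i ⬝ᵥ (d.R *ᵥ e i))
    (hred : d.redQF A τ X i (e i) a (-ω) c e ≤ 0) :
    2 * (e i ⬝ᵥ (X i *ᵥ d.errorField A X i e a c ω ωE)) + e i ⬝ᵥ (d.Q i *ᵥ e i)
      + ((d.pdeg i + d.qdeg i : ℕ) : ℝ) * (e i ⬝ᵥ e i) + 2 * d.δ i * (e i ⬝ᵥ (X i *ᵥ e i))
      - 2 * ∑ j ∈ d.V i, e i ⬝ᵥ e j
      - ∑ j ∈ d.V i, (2 * d.δ j / ((d.qdeg j : ℝ) + 1)) * (e j ⬝ᵥ (X j *ᵥ e j))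
      ≤ d.supply i a ω ωE := by
  obtain ⟨-, hE, hF, -, hγ, -, -⟩ := hstand
  have hg : 0 ≤ d.gam ^ 2 := sq_nonneg _
  have h1 := mul_le_mul_of_nonneg_left (neg_two_mul_cross_le (hE i) (d.D2 i) (d.C2 i) (e i) ω) hg
  have h2 : d.gam ^ 2 * ∑ j ∈ d.V i, (-2 * ((d.H i j *ᵥ e i) ⬝ᵥ ((d.F i j)⁻¹ *ᵥ (d.G i j *ᵥ ωE j)))
        - (d.H i j *ᵥ e i) ⬝ᵥ ((d.F i j)⁻¹ *ᵥ (d.H i j *ᵥ e i)))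
      ≤ d.gam ^ 2 * ∑ j ∈ d.V i,
        frobNorm ((d.G i j)ᵀ * (d.F i j)⁻¹ * d.G i j) * (ωE j ⬝ᵥ ωE j) :=
    mul_le_mul_of_nonneg_left (Finset.sum_le_sum fun j hj =>
      neg_two_mul_cross_le (hF i j hj) (d.G i j) (d.H i j) (e i) (ωE j)) hg
  have h3 := mul_le_mul_of_nonneg_left hc hτ
  simp only [redQF, d.dotProduct_Smat_mulVec hX] at hred
  simp only [errorField, supply, Matrix.mulVec_add, Matrix.mulVec_sub, Matrix.mulVec_sum,
    dotProduct_add, dotProduct_sub, dotProduct_sum, d.mulVec_Lgain_mulVec hX,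
    d.mulVec_Kgain_mulVec hX]
  simp only [← Matrix.mulVec_mulVec, Matrix.sub_mulVec, Matrix.one_mulVec, Matrix.smul_mulVec,
    Matrix.mulVec_sub, Matrix.mulVec_neg, dotProduct_sub, dotProduct_neg, neg_dotProduct,
    dotProduct_smul, smul_eq_mul, dotProduct_transpose_mulVec', neg_neg, mul_add, mul_sub, add_mul,
    Finset.sum_add_distrib, Finset.sum_sub_distrib, mul_assoc, ← Finset.mul_sum] at *
  linarith

theorem sum_sum_inNeighbours (f : Fin N → ℝ) :
    ∑ i, ∑ j ∈ d.V i, f j = ∑ j, (d.qdeg j : ℝ) * f j := by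
  rw [Finset.sum_comm' (t' := Finset.univ) (s' := fun j => Finset.univ.filter fun i => j ∈ d.V i)
    (by simp)]
  simp [qdeg]

theorem network_dissipation (hstand : d.Standing) {A : Matrix (Fin n) (Fin n) ℝ} {τ : Fin N → ℝ}
    {X : Fin N → Matrix (Fin n) (Fin n) ℝ} (hX : ∀ i, (X i).PosDef) (hτ : ∀ i, 0 ≤ τ i)
    {ε : ℝ} (hε : ∀ i, ε ≤ 2 * d.δ i / ((d.qdeg i : ℝ) + 1))
    (e : Fin N → Fin n → ℝ) (a : Fin r0 → ℝ) (c : Fin N → Fin l → ℝ) (ω : Fin N → Fin r → ℝ)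
    (ωE : Fin N → Fin N → Fin r → ℝ) (hc : ∀ i, c i ⬝ᵥ c i ≤ e i ⬝ᵥ (d.R *ᵥ e i))
    (hred : ∀ i, d.redQF A τ X i (e i) a (-ω i) (c i) e ≤ 0) :
    ∑ i, (2 * (e i ⬝ᵥ (X i *ᵥ d.errorField A X i e a (c i) (ω i) (ωE i)))
        + e i ⬝ᵥ (d.Q i *ᵥ e i))
      ≤ -ε * ∑ i, e i ⬝ᵥ (X i *ᵥ e i) + ∑ i, d.supply i a (ω i) (ωE i) := by
  have h1 := Finset.sum_le_sum fun i (_ : i ∈ Finset.univ) =>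
    d.node_dissipation hstand (hX i) (hτ i) e a (c i) (ω i) (ωE i) (hc i) (hred i)
  have h2 : ∑ i, ∑ j ∈ d.V i, (2 * (e i ⬝ᵥ e j) - e i ⬝ᵥ e i - e j ⬝ᵥ e j) ≤ 0 := by
    refine Finset.sum_nonpos fun i _ => Finset.sum_nonpos fun j _ => ?_
    have h := dotProduct_self_nonneg' (e i - e j)
    simp only [dotProduct_sub, sub_dotProduct, dotProduct_comm (e j) (e i)] at h
    linarith
  have h3 : ∑ i, (-(2 * d.δ i) + (d.qdeg i : ℝ) * (2 * d.δ i / ((d.qdeg i : ℝ) + 1)))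
      * (e i ⬝ᵥ (X i *ᵥ e i)) ≤ ∑ i, -ε * (e i ⬝ᵥ (X i *ᵥ e i)) := by
    refine Finset.sum_le_sum fun i _ =>
      mul_le_mul_of_nonneg_right ?_ (posDef_dotProduct_mulVec_nonneg (hX i) _)
    have hq : (0 : ℝ) < (d.qdeg i : ℝ) + 1 := by positivity
    have h : -(2 * d.δ i) + (d.qdeg i : ℝ) * (2 * d.δ i / ((d.qdeg i : ℝ) + 1))
        = -(2 * d.δ i / ((d.qdeg i : ℝ) + 1)) := by
      field_simp
      ring
    rw [h]
    exact neg_le_neg (hε i)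
  have h4 : ∑ i, ∑ j ∈ d.V i, e i ⬝ᵥ e i = ∑ i, (d.pdeg i : ℝ) * (e i ⬝ᵥ e i) := by
    simp [pdeg]
  have h5 := d.sum_sum_inNeighbours fun j => e j ⬝ᵥ e j
  have h6 := d.sum_sum_inNeighbours fun j =>
    (2 * d.δ j / ((d.qdeg j : ℝ) + 1)) * (e j ⬝ᵥ (X j *ᵥ e j))
  simp only [Finset.sum_add_distrib, Finset.sum_sub_distrib, Nat.cast_add, add_mul, neg_mul,
    Finset.sum_neg_distrib, ← Finset.mul_sum, mul_assoc] at *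
  linarith

theorem supply_nonneg (i : Fin N) (a : Fin r0 → ℝ) (ω : Fin r → ℝ) (ωE : Fin N → Fin r → ℝ) :
    0 ≤ d.supply i a ω ωE := by
  have hf : ∀ M : Matrix (Fin r) (Fin r) ℝ, 0 ≤ frobNorm M := fun M => Real.sqrt_nonneg _
  have ha := dotProduct_self_nonneg' a
  have hω := dotProduct_self_nonneg' ω
  have hE := fun j => dotProduct_self_nonneg' (ωE j)
  have h1 := hf ((d.D2 i)ᵀ * (d.E i)⁻¹ * d.D2 i)
  refine add_nonneg (by positivity) (Finset.sum_nonneg fun j _ => ?_)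
  exact mul_nonneg (mul_nonneg (sq_nonneg _) (hf _)) (hE j)

theorem integrableOn_supply {w0 : ℝ → Fin r0 → ℝ} {w : Fin N → ℝ → Fin r → ℝ}
    {wE : Fin N → Fin N → ℝ → Fin r → ℝ} (hw0 : IsL2 w0) (hw : ∀ i, IsL2 (w i))
    (hwE : ∀ i j, j ∈ d.V i → IsL2 (wE i j)) :
    IntegrableOn (fun t => ∑ i, d.supply i (w0 t) (w i t) fun j => wE i j t) (Ici 0) := by
  refine integrable_finsetSum _ fun i _ => ?_
  refine ((hw0.const_mul _).add ((hw i).const_mul _)).add ?_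
  exact integrable_finsetSum _ fun j hj => (hwE i j hj).const_mul _

/-- The synchronization errors of a closed-loop solution obey the error dynamics. -/
theorem hasDerivAt_error {Aρ : ℝ → Matrix (Fin n) (Fin n) ℝ} {φ : (Fin n → ℝ) → Fin l → ℝ}
    {X : ℝ → Fin N → Matrix (Fin n) (Fin n) ℝ}
    {w0 : ℝ → Fin r0 → ℝ} {w : Fin N → ℝ → Fin r → ℝ} {wE : Fin N → Fin N → ℝ → Fin r → ℝ}
    {x : ℝ → Fin n → ℝ} {xa : Fin N → ℝ → Fin n → ℝ}
    (hcl : d.ClosedLoop Aρ φ (fun _ _ => 0) (fun t => d.Kgain (X t)) (fun t => d.Lgain (X t))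
      w0 w wE x xa) {t : ℝ} (ht : t ∈ Ici (0 : ℝ)) (i : Fin N) :
    HasDerivAt (fun t => x t - xa i t)
      (d.errorField (Aρ t) (X t) i (fun j => x t - xa j t) (w0 t) (φ (x t) - φ (xa i t)) (w i t)
        fun j => wE i j t) t := by
  refine ((hcl.1 t ht).sub (hcl.2 i t ht)).congr_deriv (Eq.symm ?_)
  have h : ∀ j, d.H i j *ᵥ ((x t - xa i t) - (x t - xa j t)) + d.G i j *ᵥ wE i j t
      = (d.H i j *ᵥ xa j t + d.G i j *ᵥ wE i j t) - d.H i j *ᵥ xa i t := fun j => by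
    rw [sub_sub_sub_cancel_left, Matrix.mulVec_sub]
    abel
  simp only [errorField, h, add_zero]
  simp only [Matrix.mulVec_sub, Matrix.mulVec_add]
  abel

end NetData

/-! ### Interpolation along the grid -/

section Grid

variable {K : ℕ} {grid u b : ℕ → ℝ}

theorem exists_mem_grid_cell (hK : 0 < K) {s : ℝ} (hs : s ∈ Icc (grid 0) (grid K)) :
    ∃ k < K, s ∈ Icc (grid k) (grid (k + 1)) := by
  induction K with
  | zero => exact absurd hK (lt_irrefl 0)
  | succ K ih =>
    rcases le_total (grid K) s with h | h
    · exact ⟨K, K.lt_succ_self, h, hs.2⟩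
    · rcases K.eq_zero_or_pos with rfl | h0
      · exact ⟨0, Nat.one_pos, hs⟩
      · obtain ⟨k, hk, hks⟩ := ih h0 ⟨hs.1, h⟩
        exact ⟨k, hk.trans K.lt_succ_self, hks⟩

theorem grid_le_grid (hc : ∀ k < K, grid k < u k ∧ u k < b k ∧ b k < grid (k + 1)) {j k : ℕ}
    (hjk : j ≤ k) (hk : k ≤ K) : grid j ≤ grid k := by
  induction k, hjk using Nat.le_induction with
  | base => rfl
  | succ k _ ih =>
    obtain ⟨h1, h2, h3⟩ := hc k hk
    exact (ih (Nat.le_of_succ_le hk)).trans (h1.trans (h2.trans h3)).le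

theorem lt_or_gt_of_mem_grid_cell
    (hc : ∀ k < K, grid k < u k ∧ u k < b k ∧ b k < grid (k + 1)) {k : ℕ} (hk : k < K) {s : ℝ}
    (hs : s ∈ Icc (grid k) (grid (k + 1))) {j : ℕ} (hj : j < K) :
    (j < k → b j < s) ∧ (k < j → s < u j) :=
  ⟨fun h => (hc j hj).2.2.trans_le ((grid_le_grid hc h hk.le).trans hs.1),
    fun h => (hs.2.trans (grid_le_grid hc h hj.le)).trans_lt (hc j hj).1⟩

theorem add_sum_ramp_smul {E : Type*} [AddCommGroup E] [Module ℝ E] (Y : ℕ → E)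
    (hc : ∀ k < K, grid k < u k ∧ u k < b k ∧ b k < grid (k + 1)) {k : ℕ} (hk : k < K) {s : ℝ}
    (hs : s ∈ Icc (grid k) (grid (k + 1))) :
    Y 0 + ∑ j ∈ Finset.range K, ramp (u j) (b j) s • (Y (j + 1) - Y j)
      = Y k + ramp (u k) (b k) s • (Y (k + 1) - Y k) := by
  have h1 : ∑ j ∈ Finset.range (k + 1), ramp (u j) (b j) s • (Y (j + 1) - Y j)
      = ∑ j ∈ Finset.range K, ramp (u j) (b j) s • (Y (j + 1) - Y j) := by
    refine Finset.sum_subset (Finset.range_mono hk) fun j hj hjk => ?_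
    have hjK := Finset.mem_range.1 hj
    have hkj : k < j := by simpa [Nat.lt_succ_iff] using hjk
    rw [ramp_of_le (hc j hjK).2.1 ((lt_or_gt_of_mem_grid_cell hc hk hs hjK).2 hkj).le, zero_smul]
  have h2 : ∑ j ∈ Finset.range k, ramp (u j) (b j) s • (Y (j + 1) - Y j) = Y k - Y 0 := by
    rw [← Finset.sum_range_sub]
    refine Finset.sum_congr rfl fun j hj => ?_
    have hjk := Finset.mem_range.1 hj
    have hjK := hjk.trans hk
    rw [ramp_of_ge (hc j hjK).2.1 ((lt_or_gt_of_mem_grid_cell hc hk hs hjK).1 hjk).le, one_smul]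
  rw [← h1, Finset.sum_range_succ, h2]
  abel

end Grid

theorem hasDerivAt_dotProduct_mulVec {n : ℕ} {e : ℝ → Fin n → ℝ} {e' : Fin n → ℝ} {t : ℝ}
    (he : HasDerivAt e e' t) (M : Matrix (Fin n) (Fin n) ℝ) :
    HasDerivAt (fun t => e t ⬝ᵥ (M *ᵥ e t)) (e' ⬝ᵥ (M *ᵥ e t) + e t ⬝ᵥ (M *ᵥ e')) t := by
  have hi := hasDerivAt_pi.1 he
  have hM : ∀ a, HasDerivAt (fun t => (M *ᵥ e t) a) ((M *ᵥ e') a) t := fun a =>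
    HasDerivAt.fun_sum (u := Finset.univ) fun j _ => (hi j).const_mul (M a j)
  have h := HasDerivAt.fun_sum (u := Finset.univ) fun a _ => (hi a).mul (hM a)
  rw [Finset.sum_add_distrib] at h
  exact h

/-- Right derivative of a quadratic form whose matrix is interpolated along the grid by a
scheduling signal, under a bound on the rate of variation. -/
theorem exists_hasDerivWithinAt_interpolated {n K : ℕ} {grid u b : ℕ → ℝ}
    (hc : ∀ k < K, grid k < u k ∧ u k < b k ∧ b k < grid (k + 1)) (hK : 0 < K)
    (Y : ℕ → Matrix (Fin n) (Fin n) ℝ) {ρ : ℝ → ℝ} {ρ' t : ℝ} (hρ : HasDerivAt ρ ρ' t)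
    (hρt : ρ t ∈ Icc (grid 0) (grid K)) {e : ℝ → Fin n → ℝ} {e' : Fin n → ℝ}
    (he : HasDerivAt e e' t) {β : ℝ}
    (hβ : ∀ k < K, |ρ'| * (frobNorm (Y (k + 1) - Y k) / (b k - u k)) * (e t ⬝ᵥ e t) ≤ β) :
    ∃ V' : ℝ,
      HasDerivWithinAt (fun z => e z ⬝ᵥ ((Y 0 + ∑ k ∈ Finset.range K,
        ramp (u k) (b k) (ρ z) • (Y (k + 1) - Y k)) *ᵥ e z)) V' (Ioi t) t ∧
      V' ≤ e' ⬝ᵥ ((Y 0 + ∑ k ∈ Finset.range K,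
          ramp (u k) (b k) (ρ t) • (Y (k + 1) - Y k)) *ᵥ e t)
        + e t ⬝ᵥ ((Y 0 + ∑ k ∈ Finset.range K,
          ramp (u k) (b k) (ρ t) • (Y (k + 1) - Y k)) *ᵥ e') + β := by
  have hp : ∀ k, ∃ p : ℝ, k < K → 0 ≤ p ∧ p ≤ 1 ∧ (ρ t ∉ Icc (u k) (b k) → p = 0) ∧
      HasDerivWithinAt (fun z => ramp (u k) (b k) (ρ z)) (p * (ρ' / (b k - u k))) (Ioi t) t := by
    intro k
    by_cases hk : k < K
    · obtain ⟨p, hp⟩ := exists_hasDerivWithinAt_ramp (hc k hk).2.1 hρ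
      exact ⟨p, fun _ => hp⟩
    · exact ⟨0, fun h => absurd h hk⟩
  choose p hp using hp
  have hq := fun M => (hasDerivAt_dotProduct_mulVec he M).hasDerivWithinAt (s := Ioi t)
  have hder := (hq (Y 0)).add (HasDerivWithinAt.fun_sum (u := Finset.range K) fun k hk =>
    (hp k (Finset.mem_range.1 hk)).2.2.2.mul (hq (Y (k + 1) - Y k)))
  refine ⟨_, hder.congr_of_eventuallyEq (Eventually.of_forall fun z => ?_) ?_, ?_⟩
  · simp [Matrix.add_mulVec, Matrix.sum_mulVec, Matrix.smul_mulVec, dotProduct_add,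
      dotProduct_sum]
  · simp [Matrix.add_mulVec, Matrix.sum_mulVec, Matrix.smul_mulVec, dotProduct_add,
      dotProduct_sum]
  have hrate : ∑ k ∈ Finset.range K, p k * (ρ' / (b k - u k))
      * (e t ⬝ᵥ ((Y (k + 1) - Y k) *ᵥ e t)) ≤ β := by
    obtain ⟨k, hk, hks⟩ := exists_mem_grid_cell hK hρt
    rw [Finset.sum_eq_single_of_mem k (Finset.mem_range.2 hk)]
    · obtain ⟨hp0, hp1, -, -⟩ := hp k hk
      have hbu : 0 < b k - u k := sub_pos.2 (hc k hk).2.1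
      have hM := abs_dotProduct_mulVec_le_frobNorm (Y (k + 1) - Y k) (e t)
      refine (le_abs_self _).trans (le_trans ?_ (hβ k hk))
      rw [abs_mul, abs_mul, abs_div, abs_of_nonneg hp0, abs_of_pos hbu]
      calc p k * (|ρ'| / (b k - u k)) * |e t ⬝ᵥ ((Y (k + 1) - Y k) *ᵥ e t)|
          ≤ 1 * (|ρ'| / (b k - u k)) * (frobNorm (Y (k + 1) - Y k) * (e t ⬝ᵥ e t)) := by
            gcongr
        _ = _ := by ring
    · intro j hj hjk
      have hjK := Finset.mem_range.1 hj
      have hcell := lt_or_gt_of_mem_grid_cell hc hk hks hjK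
      have h0 : p j = 0 := by
        refine (hp j hjK).2.2.1 fun hmem => ?_
        rcases lt_or_gt_of_ne hjk with h | h
        · exact absurd (hcell.1 h) (not_lt.2 hmem.2)
        · exact absurd (hcell.2 h) (not_lt.2 hmem.1)
      rw [h0, zero_mul, zero_mul]
  simp only [Matrix.add_mulVec, Matrix.sum_mulVec, Matrix.smul_mulVec, dotProduct_add,
    dotProduct_sum, dotProduct_smul, smul_eq_mul, Finset.sum_add_distrib, mul_add] at hrate ⊢
  linarith

theorem exists_pos_le_of_finite {ι : Type*} [Finite ι] {f : ι → ℝ} (hf : ∀ i, 0 < f i) :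
    ∃ c > 0, ∀ i, c ≤ f i := by
  rcases isEmpty_or_nonempty ι with h | h
  · exact ⟨1, one_pos, fun i => h.elim i⟩
  · obtain ⟨i, hi⟩ := Finite.exists_min f
    exact ⟨f i, hf i, hi⟩

/-- **Theorem 2, property (iii) (STATEMENT 9).** Under the rate condition (23),
the interpolated gain-scheduled protocol yields asymptotic synchronization:
`Σᵢ ‖x(t) − xᵢ(t)‖² → 0` for all `L₂` disturbances. -/
theorem interpolated_asymptotic_sync
    {n l m r r0 N : ℕ} (hN : 0 < N) (d : NetData n l m r r0 N) (hstand : d.Standing)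
    (φ : (Fin n → ℝ) → Fin l → ℝ) (hφ : d.LipOK φ)
    -- the parameter interval Γ = [ρmin, ρmax], the continuous matrix function A(·)
    -- and the continuously differentiable scheduling signal ρ(·) with values in Γ
    (ρmin ρmax : ℝ) (hΓ : ρmin < ρmax)
    (Afun : ℝ → Matrix (Fin n) (Fin n) ℝ) (hAcont : ContinuousOn Afun (Icc ρmin ρmax))
    (ρfun ρ' : ℝ → ℝ) (hρmem : ∀ t ∈ Ici (0:ℝ), ρfun t ∈ Icc ρmin ρmax)
    (hρder : ∀ t, HasDerivAt ρfun (ρ' t) t) (hρ'cont : Continuous ρ')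
    -- grid points ρ¹ < … < ρᴹ (indexed 0,…,M−1) and overlap points
    -- ρᵏ < ρ̲ᵏ⁺¹ (= u k) < ρ̄ᵏ (= b k) < ρᵏ⁺¹
    (M : ℕ) (hM : 2 ≤ M) (grid u b : ℕ → ℝ) (αg : ℕ → ℝ)
    (hg0 : grid 0 = ρmin) (hgM : grid (M - 1) = ρmax)
    (hcorner : ∀ k, k + 1 ≤ M - 1 →
      grid k < u k ∧ u k < b k ∧ b k < grid (k + 1))
    (hαg : ∀ k ≤ M - 1, 0 < αg k)
    -- the covering conditions (19), (20)
    (hcovA : ∀ k, k + 1 ≤ M - 1 → ∀ s ∈ Ico (grid k) (b k),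
      ((αg k) ^ 2 • (1 : Matrix (Fin n) (Fin n) ℝ)
        - (Afun s - Afun (grid k))ᵀ * (Afun s - Afun (grid k))).PosSemidef)
    (hcovB : ∀ k, k + 1 ≤ M - 1 → ∀ s ∈ Ioc (u k) (grid (k + 1)),
      ((αg (k + 1)) ^ 2 • (1 : Matrix (Fin n) (Fin n) ℝ)
        - (Afun s - Afun (grid (k + 1)))ᵀ * (Afun s - Afun (grid (k + 1)))).PosSemidef)
    -- feasible solutions of the coupled LMIs (12) at each grid point
    (τg θg : ℕ → Fin N → ℝ) (Xg : ℕ → Fin N → Matrix (Fin n) (Fin n) ℝ)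
    (hfeas : ∀ k ≤ M - 1, d.Feasible (Afun (grid k)) (αg k) (τg k) (θg k) (Xg k))
    -- the piecewise-affine interpolation (21) of the matrices X_{i,ρ}
    (Xρ : Fin N → ℝ → Matrix (Fin n) (Fin n) ℝ)
    (hXρ1 : ∀ k, k + 1 ≤ M - 1 → ∀ i, ∀ s ∈ Icc (grid k) (u k), Xρ i s = Xg k i)
    (hXρ2 : ∀ k, k + 1 ≤ M - 1 → ∀ i, ∀ s ∈ Icc (u k) (b k),
      Xρ i s = ((b k - s) / (b k - u k)) • Xg k i
        + ((s - u k) / (b k - u k)) • Xg (k + 1) i)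
    (hXρ3 : ∀ k, k + 1 ≤ M - 1 → ∀ i, ∀ s ∈ Icc (b k) (grid (k + 1)),
      Xρ i s = Xg (k + 1) i)
    -- ρ(0) is not a corner point, and the set of times at which ρ(t) is a corner
    -- point has zero Lebesgue measure
    (hρ0corner : ¬ ∃ k, k + 1 ≤ M - 1 ∧ (ρfun 0 = u k ∨ ρfun 0 = b k)
        ∧ ρmin < ρfun 0 ∧ ρfun 0 < ρmax)
    (hnull : volume {t : ℝ | ∃ k, k + 1 ≤ M - 1 ∧ (ρfun t = u k ∨ ρfun t = b k)
        ∧ ρmin < ρfun t ∧ ρfun t < ρmax} = 0)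
    -- the rate-of-variation bound (23):
    -- sup|ρ̇| ≤ minᵢ λ_min(Qᵢ)·[sup_k ‖X_{i,ρᵏ⁺¹} − X_{i,ρᵏ}‖/(ρ̄ᵏ − ρ̲ᵏ⁺¹)]⁻¹,
    -- stated via the Rayleigh-quotient characterization of λ_min(Qᵢ)
    (hrate : ∀ t ∈ Ici (0:ℝ), ∀ i, ∀ k, k + 1 ≤ M - 1 → ∀ ξ : Fin n → ℝ,
      |ρ' t| * (frobNorm (Xg (k + 1) i - Xg k i) / (b k - u k)) * (ξ ⬝ᵥ ξ)
        ≤ ξ ⬝ᵥ (d.Q i *ᵥ ξ))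
    -- `L₂` disturbances
    (w0 : ℝ → Fin r0 → ℝ) (w : Fin N → ℝ → Fin r → ℝ)
    (wE : Fin N → Fin N → ℝ → Fin r → ℝ)
    (hw0 : IsL2 w0) (hw : ∀ i, IsL2 (w i)) (hwE : ∀ i j, j ∈ d.V i → IsL2 (wE i j))
    -- a solution of the closed-loop system with the interpolated gains (22)
    (x : ℝ → Fin n → ℝ) (xa : Fin N → ℝ → Fin n → ℝ)
    (hcl : d.ClosedLoop (fun t => Afun (ρfun t)) φ (fun _ _ => 0)
      (fun t => d.Kgain (fun i => Xρ i (ρfun t)))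
      (fun t => d.Lgain (fun i => Xρ i (ρfun t))) w0 w wE x xa)
    :
    Filter.Tendsto (fun t => ∑ i, (x t - xa i t) ⬝ᵥ (x t - xa i t))
      Filter.atTop (nhds 0) := by
  obtain ⟨K, rfl⟩ : ∃ K, M = K + 1 := ⟨M - 1, by omega⟩
  simp only [Nat.add_sub_cancel] at *
  have hK : 0 < K := by omega
  have hγδ := hstand.2.2.2.2.2.1
  have hc : ∀ k < K, grid k < u k ∧ u k < b k ∧ b k < grid (k + 1) := fun k hk => hcorner k hk
  subst hg0 hgM
  -- the interpolated matrices as convex combinations of neighbouring grid solutions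
  have hrep : ∀ s ∈ Icc (grid 0) (grid K), ∀ i, Xρ i s
      = Xg 0 i + ∑ k ∈ Finset.range K, ramp (u k) (b k) s • (Xg (k + 1) i - Xg k i) := by
    intro s hs i
    obtain ⟨k, hk, hks⟩ := exists_mem_grid_cell hK hs
    have hub := (hc k hk).2.1
    rw [add_sum_ramp_smul (fun j => Xg j i) hc hk hks]
    rcases le_total s (u k) with h | h
    · rw [hXρ1 k hk i s ⟨hks.1, h⟩, ramp_of_le hub h, zero_smul, add_zero]
    rcases le_total s (b k) with h' | h'
    · have hbu : b k - u k ≠ 0 := (sub_pos.2 hub).ne'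
      have h1 : (b k - s) / (b k - u k) = 1 - (s - u k) / (b k - u k) := by
        field_simp
        ring
      rw [hXρ2 k hk i s ⟨h, h'⟩, ramp_of_mem hub ⟨h, h'⟩, h1, sub_smul, one_smul, smul_sub]
      abel
    · rw [hXρ3 k hk i s ⟨h', hks.2⟩, ramp_of_ge hub h', one_smul]
      abel
  -- uniform coercivity of the grid solutions
  obtain ⟨κ, hκ, hκg⟩ : ∃ κ > 0, ∀ k ≤ K, ∀ i, ∀ ξ : Fin n → ℝ,
      κ * (ξ ⬝ᵥ ξ) ≤ ξ ⬝ᵥ (Xg k i *ᵥ ξ) := by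
    have h : ∀ z : Fin (K + 1) × Fin N, ∃ κ > 0, ∀ ξ : Fin n → ℝ,
        κ * (ξ ⬝ᵥ ξ) ≤ ξ ⬝ᵥ (Xg z.1 z.2 *ᵥ ξ) := fun z =>
      exists_pos_mul_dotProduct_le_of_posDef ((hfeas z.1 (Nat.lt_succ_iff.1 z.1.2)).2.2.1 z.2)
    choose f hf hfz using h
    obtain ⟨κ, hκ, hκf⟩ := exists_pos_le_of_finite hf
    exact ⟨κ, hκ, fun k hk i ξ => (mul_le_mul_of_nonneg_right
      (hκf (⟨k, Nat.lt_succ_iff.2 hk⟩, i)) (dotProduct_self_nonneg' ξ)).trans (hfz _ ξ)⟩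
  -- the reduced LMIs hold along the whole parameter interval
  have hLMI : ∀ s ∈ Icc (grid 0) (grid K), (∀ i, (Xρ i s).PosDef) ∧
      (∀ i, ∀ ξ : Fin n → ℝ, κ * (ξ ⬝ᵥ ξ) ≤ ξ ⬝ᵥ (Xρ i s *ᵥ ξ)) ∧
      ∃ τ : Fin N → ℝ, (∀ i, 0 ≤ τ i) ∧ ∀ i ξ a bv c v,
        d.redQF (Afun s) τ (fun i => Xρ i s) i ξ a bv c v ≤ 0 := by
    intro s hs
    obtain ⟨k, hk, hks⟩ := exists_mem_grid_cell hK hs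
    obtain ⟨h1, hub, h3⟩ := hc k hk
    have hfk := hfeas k hk.le
    have hfk' := hfeas (k + 1) hk
    rcases le_or_gt s (u k) with h | h
    · have hX : (fun i => Xρ i s) = Xg k := funext fun i => hXρ1 k hk i s ⟨hks.1, h⟩
      have hX' : ∀ i, Xρ i s = _ := fun i => congrFun hX i
      simp only [hX']
      exact ⟨hfk.2.2.1, hκg k hk.le, τg k, fun i => (hfk.1 i).le,
        d.redQF_nonpos hfk (hcovA k hk s ⟨hks.1, h.trans_lt hub⟩)⟩
    rcases le_or_gt (b k) s with h' | h'
    · have hX : (fun i => Xρ i s) = Xg (k + 1) := funext fun i => hXρ3 k hk i s ⟨h', hks.2⟩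
      have hX' : ∀ i, Xρ i s = _ := fun i => congrFun hX i
      simp only [hX']
      exact ⟨hfk'.2.2.1, hκg (k + 1) hk, τg (k + 1), fun i => (hfk'.1 i).le,
        d.redQF_nonpos hfk' (hcovB k hk s ⟨h, hks.2⟩)⟩
    · have hbu : 0 < b k - u k := sub_pos.2 hub
      obtain ⟨p, hp⟩ : ∃ p, p = (b k - s) / (b k - u k) := ⟨_, rfl⟩
      obtain ⟨q, hq⟩ : ∃ q, q = (s - u k) / (b k - u k) := ⟨_, rfl⟩
      have hp0 : 0 < p := hp ▸ div_pos (sub_pos.2 h') hbu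
      have hq0 : 0 < q := hq ▸ div_pos (sub_pos.2 h) hbu
      have hpq : p + q = 1 := by
        rw [hp, hq]
        field_simp
        ring
      have hX : ∀ i, Xρ i s = p • Xg k i + q • Xg (k + 1) i := fun i => by
        rw [hXρ2 k hk i s ⟨h.le, h'.le⟩, hp, hq]
      have hpd : ∀ i, (p • Xg k i + q • Xg (k + 1) i).PosDef := fun i =>
        ((hfk.2.2.1 i).smul hp0).add ((hfk'.2.2.1 i).smul hq0)
      simp only [hX]
      refine ⟨hpd, fun i ξ => ?_, fun i => p * τg k i + q * τg (k + 1) i, fun i => ?_,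
        fun i ξ a bv c v => ?_⟩
      · simp only [Matrix.add_mulVec, Matrix.smul_mulVec, dotProduct_add, dotProduct_smul,
          smul_eq_mul]
        calc κ * (ξ ⬝ᵥ ξ) = p * (κ * (ξ ⬝ᵥ ξ)) + q * (κ * (ξ ⬝ᵥ ξ)) := by
              rw [← add_mul, hpq, one_mul]
          _ ≤ _ := add_le_add (mul_le_mul_of_nonneg_left (hκg k hk.le i ξ) hp0.le)
              (mul_le_mul_of_nonneg_left (hκg (k + 1) hk i ξ) hq0.le)
      · exact add_nonneg (mul_nonneg hp0.le (hfk.1 i).le) (mul_nonneg hq0.le (hfk'.1 i).le)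
      · rw [d.redQF_combination hpq hfk.2.2.1 hfk'.2.2.1 hpd]
        exact add_nonpos
          (mul_nonpos_of_nonneg_of_nonpos hp0.le
            (d.redQF_nonpos hfk (hcovA k hk s ⟨hks.1, h'⟩) i ξ a bv c v))
          (mul_nonpos_of_nonneg_of_nonpos hq0.le
            (d.redQF_nonpos hfk' (hcovB k hk s ⟨h, hks.2⟩) i ξ a bv c v))
  obtain ⟨ε, hε, hεi⟩ := exists_pos_le_of_finite
    (f := fun i => 2 * d.δ i / ((d.qdeg i : ℝ) + 1))
    (fun i => div_pos (mul_pos two_pos (hγδ i)) (by positivity))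
  have herr := fun t (ht : t ∈ Ici (0 : ℝ)) i =>
    d.hasDerivAt_error (X := fun t i => Xρ i (ρfun t)) hcl ht i
  -- the storage function and its right derivative
  set W : Fin N → ℝ → ℝ := fun i z => (x z - xa i z) ⬝ᵥ ((Xg 0 i + ∑ k ∈ Finset.range K,
    ramp (u k) (b k) (ρfun z) • (Xg (k + 1) i - Xg k i)) *ᵥ (x z - xa i z)) with hW
  have hWX : ∀ t ∈ Ici (0 : ℝ), ∀ i,
      W i t = (x t - xa i t) ⬝ᵥ (Xρ i (ρfun t) *ᵥ (x t - xa i t)) := fun t ht i => by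
    rw [hrep _ (hρmem t ht) i]
  have hder : ∀ t, ∃ V' : ℝ, t ∈ Ici (0 : ℝ) →
      HasDerivWithinAt (fun z => ∑ i, W i z) V' (Ioi t) t ∧
      V' ≤ -ε * ∑ i, W i t + ∑ i, d.supply i (w0 t) (w i t) fun j => wE i j t := by
    intro t
    by_cases ht : t ∈ Ici (0 : ℝ)
    swap
    · exact ⟨0, fun h => absurd h ht⟩
    have h1 := fun i => exists_hasDerivWithinAt_interpolated hc hK (fun k => Xg k i) (hρder t)
      (hρmem t ht) (herr t ht i) (fun k hk => hrate t ht i k hk (x t - xa i t))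
    choose V' hV' hle using h1
    refine ⟨∑ i, V' i, fun _ => ⟨HasDerivWithinAt.fun_sum fun i _ => hV' i, ?_⟩⟩
    obtain ⟨hX, -, τ, hτ, hred⟩ := hLMI _ (hρmem t ht)
    have h2 := d.network_dissipation hstand (X := fun i => Xρ i (ρfun t)) hX hτ hεi
      (fun i => x t - xa i t) (w0 t) (fun i => φ (x t) - φ (xa i t)) (fun i => w i t)
      (fun i j => wE i j t) (fun i => hφ _ _) (fun i => hred i _ _ _ _ _)
    simp only [hWX t ht]
    refine le_trans (Finset.sum_le_sum fun i _ => ?_) h2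
    have h3 := hle i
    simp only [← hrep _ (hρmem t ht) i] at h3
    rw [dotProduct_mulVec_comm_of_posDef (hX i) _ (x t - xa i t), ← two_mul] at h3
    exact h3
  choose V' hV' using hder
  have hρcont : Continuous ρfun := continuous_iff_continuousAt.2 fun t => (hρder t).continuousAt
  have hWcont : ContinuousOn (fun z => ∑ i, W i z) (Ici 0) := by
    refine continuousOn_finsetSum _ fun i _ => ?_
    have he : ContinuousOn (fun z => x z - xa i z) (Ici 0) := fun t ht =>
      (herr t ht i).continuousAt.continuousWithinAt
    have hq : ∀ Y : Matrix (Fin n) (Fin n) ℝ,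
        ContinuousOn (fun z => (x z - xa i z) ⬝ᵥ (Y *ᵥ (x z - xa i z))) (Ici 0) := fun Y =>
      (by fun_prop : Continuous fun ξ : Fin n → ℝ => ξ ⬝ᵥ (Y *ᵥ ξ)).comp_continuousOn he
    simp only [hW, Matrix.add_mulVec, Matrix.sum_mulVec, Matrix.smul_mulVec, dotProduct_add,
      dotProduct_sum, dotProduct_smul, smul_eq_mul]
    exact (hq _).add (continuousOn_finsetSum _ fun k _ =>
      ((continuous_ramp _ _).comp hρcont).continuousOn.mul (hq _))
  have hWlow : ∀ t ∈ Ici (0 : ℝ), ∀ i, κ * ((x t - xa i t) ⬝ᵥ (x t - xa i t)) ≤ W i t :=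
    fun t ht i => (hWX t ht i).symm ▸ (hLMI _ (hρmem t ht)).2.1 i _
  have hlim := tendsto_zero_of_hasDerivWithinAt_le hε
    (fun t ht => Finset.sum_nonneg fun i _ =>
      (mul_nonneg hκ.le (dotProduct_self_nonneg' _)).trans (hWlow t ht i))
    hWcont (fun t ht => (hV' t ht).1) (fun t ht => (hV' t ht).2)
    (fun t => Finset.sum_nonneg fun i _ => d.supply_nonneg i _ _ _)
    (d.integrableOn_supply hw0 hw hwE)
  have hlim' := hlim.const_mul κ⁻¹
  rw [mul_zero] at hlim'
  refine squeeze_zero' (Eventually.of_forall fun t =>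
    Finset.sum_nonneg fun i _ => dotProduct_self_nonneg' _) ?_ hlim'
  filter_upwards [eventually_ge_atTop (0 : ℝ)] with t ht
  rw [← div_eq_inv_mul, le_div_iff₀' hκ, Finset.mul_sum]
  exact Finset.sum_le_sum fun i _ => hWlow t ht i
end
end

section
/- Let X : Γ → ℝ^{n×n} be a continuous, piecewise-affine, symmetric-matrix-valued function on a compact interval Γ ⊂ ℝ, affine on each of finitely many closed subintervals whose endpoints (other than the endpoints of Γ) form the finite 'corner' set Γ̄, and assume X(ρ) is positive definite for every ρ ∈ Γ. Then for every ε > 0 there exist β > 0 and a continuously differentiable symmetric-matrix-valued function Y : Γ → ℝ^{n×n} such that: (1) ‖Y(ρ) − X(ρ)‖ < ε for every ρ within distance β of a corner point c ∈ Γ̄; (2) Y(ρ) = X(ρ) for every ρ at distance at least β from every corner point; (3) sup_{ρ∈Γ} ‖dY(ρ)/dρ‖ is at most the maximum over the subintervals of the norm of the (constant) slope of X on that subinterval; and moreover, for ε sufficiently small, Y(ρ) is positive definite for every ρ ∈ Γ. -/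
open MeasureTheory Matrix Set Filter

noncomputable section

open Topology

section FrobeniusNorm

attribute [local instance] Matrix.frobeniusNormedAddCommGroup Matrix.frobeniusNormedSpace

lemma frobNorm_eq_norm {n : ℕ} (A : Matrix (Fin n) (Fin n) ℝ) : frobNorm A = ‖A‖ := by
  rw [frobNorm, Matrix.frobenius_norm_def, Real.sqrt_eq_rpow]
  simp

lemma frobNorm_nonneg {n : ℕ} (A : Matrix (Fin n) (Fin n) ℝ) : 0 ≤ frobNorm A :=
  Real.sqrt_nonneg _

lemma frobNorm_sum_smul_le {n : ℕ} {ι : Type*} (s : Finset ι) (w : ι → ℝ)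
    (A : ι → Matrix (Fin n) (Fin n) ℝ) :
    frobNorm (∑ i ∈ s, w i • A i) ≤ ∑ i ∈ s, |w i| * frobNorm (A i) := by
  simp only [frobNorm_eq_norm]
  refine (norm_sum_le _ _).trans (Finset.sum_le_sum fun i _ => ?_)
  rw [norm_smul, Real.norm_eq_abs]

end FrobeniusNorm

lemma abs_apply_le_frobNorm {n : ℕ} (A : Matrix (Fin n) (Fin n) ℝ) (i j : Fin n) :
    |A i j| ≤ frobNorm A := by
  refine Real.abs_le_sqrt ?_
  calc (A i j) ^ 2 ≤ ∑ j, (A i j) ^ 2 :=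
        Finset.single_le_sum (f := fun j => (A i j) ^ 2) (fun _ _ => sq_nonneg _)
          (Finset.mem_univ j)
    _ ≤ ∑ i, ∑ j, (A i j) ^ 2 :=
        Finset.single_le_sum (f := fun i => ∑ j, (A i j) ^ 2)
          (fun _ _ => Finset.sum_nonneg fun _ _ => sq_nonneg _) (Finset.mem_univ i)

/-- Summation by parts: an affine path through `A 0, A 1, …` with antitone weights. -/
lemma add_sum_smul_sub_eq {E : Type*} [AddCommGroup E] [Module ℝ E] (A : ℕ → E) (v : ℕ → ℝ)
    (hv0 : v 0 = 1) (N : ℕ) :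
    A 0 + ∑ k ∈ Finset.range N, v (k + 1) • (A (k + 1) - A k) =
      ∑ k ∈ Finset.range (N + 1), (v k - if k < N then v (k + 1) else 0) • A k := by
  rw [Finset.sum_range_succ]
  have : ∑ k ∈ Finset.range N, (v k - if k < N then v (k + 1) else 0) • A k =
      ∑ k ∈ Finset.range N, (v k - v (k + 1)) • A k :=
    Finset.sum_congr rfl fun k hk => by rw [if_pos (Finset.mem_range.mp hk)]
  rw [this, if_neg (lt_irrefl N), sub_zero]
  induction N with
  | zero => simp [hv0]
  | succ N ih =>
    rw [Finset.sum_range_succ, ← add_assoc, ih, Finset.sum_range_succ]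
    · module
    · exact Finset.sum_congr rfl fun k hk => by rw [if_pos (Finset.mem_range.mp hk)]

lemma frobNorm_add_sum_smul_sub_le {n : ℕ} (A : ℕ → Matrix (Fin n) (Fin n) ℝ) (v : ℕ → ℝ)
    (hv0 : v 0 = 1) (N : ℕ) (hanti : ∀ k < N, v (k + 1) ≤ v k) (hN : 0 ≤ v N)
    (C : ℝ) (hC : ∀ k < N + 1, frobNorm (A k) ≤ C) :
    frobNorm (A 0 + ∑ k ∈ Finset.range N, v (k + 1) • (A (k + 1) - A k)) ≤ C := by
  have hw : ∑ k ∈ Finset.range (N + 1), (v k - if k < N then v (k + 1) else 0) = 1 := by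
    have := add_sum_smul_sub_eq (fun _ => (1 : ℝ)) v hv0 N
    simpa using this.symm
  rw [add_sum_smul_sub_eq A v hv0]
  refine (frobNorm_sum_smul_le _ _ _).trans ?_
  calc _ ≤ ∑ k ∈ Finset.range (N + 1), (v k - if k < N then v (k + 1) else 0) * C := by
        refine Finset.sum_le_sum fun k hk => ?_
        have hk' := Finset.mem_range.mp hk
        have h0 : 0 ≤ v k - if k < N then v (k + 1) else 0 := by
          split_ifs with h
          · exact sub_nonneg.mpr (hanti k h)
          · obtain rfl : k = N := by omega
            simpa using hN
        rw [abs_of_nonneg h0]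
        exact mul_le_mul_of_nonneg_left (hC k hk') h0
    _ = C := by rw [← Finset.sum_mul, hw, one_mul]

lemma hasDerivAt_max_zero_sq (x : ℝ) :
    HasDerivAt (fun y : ℝ => max y 0 ^ 2) (2 * max x 0) x := by
  rcases lt_trichotomy x 0 with hx | rfl | hx
  · rw [max_eq_right hx.le, mul_zero]
    refine (hasDerivAt_const x (0 : ℝ)).congr_of_eventuallyEq ?_
    filter_upwards [Iio_mem_nhds hx] with y hy
    simp [max_eq_right (le_of_lt (mem_Iio.mp hy))]
  · have h : (fun y : ℝ => max y 0 ^ 2) =O[𝓝 0] fun y => ‖y - 0‖ ^ 2 := by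
      refine Asymptotics.IsBigO.of_bound 1 (Eventually.of_forall fun y => ?_)
      rw [one_mul, sub_zero, norm_pow, norm_pow, norm_norm]
      gcongr
      rw [Real.norm_eq_abs, Real.norm_eq_abs, abs_of_nonneg (le_max_right y 0)]
      exact max_le (le_abs_self y) (abs_nonneg y)
    simpa using (h.hasFDerivAt one_lt_two).hasDerivAt
  · rw [max_eq_left hx.le]
    have h : HasDerivAt (fun y : ℝ => y ^ 2) (2 * x) x := by simpa using hasDerivAt_pow 2 x
    refine h.congr_of_eventuallyEq ?_
    filter_upwards [Ioi_mem_nhds hx] with y hy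
    rw [max_eq_left (le_of_lt (mem_Ioi.mp hy))]

/-- A `C¹` smoothing of `x ↦ max x 0`, agreeing with it outside `(-β, β)`. -/
def smoothRamp (β x : ℝ) : ℝ := (max (x + β) 0 ^ 2 - max (x - β) 0 ^ 2) / (4 * β)

/-- The derivative of `smoothRamp β`. -/
def smoothStep (β x : ℝ) : ℝ := (max (x + β) 0 - max (x - β) 0) / (2 * β)

lemma hasDerivAt_smoothRamp (β x : ℝ) :
    HasDerivAt (smoothRamp β) (smoothStep β x) x := by
  have h1 : HasDerivAt (fun y : ℝ => max (y + β) 0 ^ 2) (2 * max (x + β) 0) x :=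
    (hasDerivAt_max_zero_sq (x + β)).comp_add_const x β
  have h2 : HasDerivAt (fun y : ℝ => max (y - β) 0 ^ 2) (2 * max (x - β) 0) x :=
    (hasDerivAt_max_zero_sq (x - β)).comp_sub_const x β
  have h := (h1.sub h2).div_const (4 * β)
  have he : smoothStep β x = (2 * max (x + β) 0 - 2 * max (x - β) 0) / (4 * β) := by
    rw [smoothStep, ← mul_sub, show 4 * β = 2 * (2 * β) by ring,
      mul_div_mul_left _ _ two_ne_zero]
  rw [he]
  exact h

lemma continuous_smoothStep (β : ℝ) : Continuous (smoothStep β) := by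
  unfold smoothStep
  fun_prop

lemma smoothStep_nonneg {β : ℝ} (hβ : 0 < β) (x : ℝ) : 0 ≤ smoothStep β x :=
  div_nonneg (sub_nonneg.mpr (max_le_max_right 0 (by linarith))) (by linarith)

lemma smoothStep_le_one {β : ℝ} (hβ : 0 < β) (x : ℝ) : smoothStep β x ≤ 1 := by
  rw [smoothStep, div_le_one (by linarith)]
  rcases max_cases (x + β) 0 with h | h <;> rcases max_cases (x - β) 0 with h₁ | h₁ <;> linarith

lemma smoothStep_mono {β : ℝ} (hβ : 0 < β) : Monotone (smoothStep β) := by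
  intro x y hxy
  unfold smoothStep
  gcongr ?_ / _
  rcases max_cases (x + β) 0 with h | h <;> rcases max_cases (x - β) 0 with h₁ | h₁ <;>
    rcases max_cases (y + β) 0 with h₂ | h₂ <;> rcases max_cases (y - β) 0 with h₃ | h₃ <;>
    linarith

lemma smoothRamp_eq_of_le_abs {β x : ℝ} (hβ : 0 < β) (hx : β ≤ |x|) :
    smoothRamp β x = max x 0 := by
  rw [smoothRamp, div_eq_iff (by linarith)]
  rcases le_abs'.mp hx with h | h
  · rw [max_eq_right (by linarith), max_eq_right (by linarith), max_eq_right (by linarith)]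
    ring
  · rw [max_eq_left (by linarith), max_eq_left (by linarith), max_eq_left (by linarith)]
    ring

lemma abs_smoothRamp_sub_le {β : ℝ} (hβ : 0 < β) (x : ℝ) :
    |smoothRamp β x - max x 0| ≤ β := by
  rcases le_or_gt β |x| with h | h
  · rw [smoothRamp_eq_of_le_abs hβ h]
    simpa using hβ.le
  · obtain ⟨h1, h2⟩ := abs_lt.mp h
    have he : smoothRamp β x * (4 * β) = (x + β) ^ 2 := by
      rw [smoothRamp, div_mul_cancel₀ _ (by linarith), max_eq_left (by linarith),
        max_eq_right (by linarith)]
      ring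
    have h4 : 0 < 4 * β := by linarith
    rw [abs_le]
    constructor <;> rcases max_cases x 0 with hm | hm <;> rw [hm.1] <;>
      refine le_of_mul_le_mul_right ?_ h4 <;> rw [sub_mul, he] <;> nlinarith

lemma neg_le_dotProduct_mulVec {n : ℕ} (E : Matrix (Fin n) (Fin n) ℝ) (x : Fin n → ℝ)
    (hx : ‖x‖ ≤ 1) : -((n : ℝ) ^ 2 * frobNorm E) ≤ x ⬝ᵥ (E *ᵥ x) := by
  have hxi : ∀ i, |x i| ≤ 1 := fun i => (norm_le_pi_norm x i).trans hx
  have h : |x ⬝ᵥ (E *ᵥ x)| ≤ ∑ _i : Fin n, ∑ _j : Fin n, frobNorm E := by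
    simp only [dotProduct, mulVec, Finset.mul_sum]
    refine (Finset.abs_sum_le_sum_abs _ _).trans (Finset.sum_le_sum fun i _ => ?_)
    refine (Finset.abs_sum_le_sum_abs _ _).trans (Finset.sum_le_sum fun j _ => ?_)
    rw [abs_mul, abs_mul]
    calc |x i| * (|E i j| * |x j|) ≤ 1 * (frobNorm E * 1) := by
          gcongr
          · exact hxi i
          · exact frobNorm_nonneg E
          · exact abs_apply_le_frobNorm E i j
          · exact hxi j
      _ = frobNorm E := by ring
  have h' := (abs_le.mp h).1
  simp only [Finset.sum_const, Finset.card_univ, Fintype.card_fin, nsmul_eq_mul] at h'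
  linarith

/-- Positive definiteness along a compact path is stable under uniformly small symmetric
perturbations. -/
lemma exists_posDef_of_frobNorm_sub_lt {n : ℕ} {K : Set ℝ} (hK : IsCompact K)
    {X : ℝ → Matrix (Fin n) (Fin n) ℝ} (hX : ContinuousOn X K) (hpos : ∀ s ∈ K, (X s).PosDef) :
    ∃ ε₀ > (0 : ℝ), ∀ s ∈ K, ∀ B : Matrix (Fin n) (Fin n) ℝ, B.IsSymm →
      frobNorm (B - X s) < ε₀ → B.PosDef := by
  have hcont : ContinuousOn (fun p : ℝ × (Fin n → ℝ) => p.2 ⬝ᵥ (X p.1 *ᵥ p.2))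
      (K ×ˢ Metric.sphere 0 1) := by
    have h1 : ContinuousOn (fun p : ℝ × (Fin n → ℝ) => X p.1) (K ×ˢ Metric.sphere 0 1) :=
      hX.comp continuousOn_fst fun p hp => hp.1
    have h2 : Continuous fun q : Matrix (Fin n) (Fin n) ℝ × (Fin n → ℝ) => q.2 ⬝ᵥ (q.1 *ᵥ q.2) :=
      continuous_snd.dotProduct (continuous_fst.matrix_mulVec continuous_snd)
    exact h2.comp_continuousOn (h1.prodMk continuousOn_snd)
  obtain ⟨a, ha, hle⟩ := (hK.prod (isCompact_sphere (0 : Fin n → ℝ) 1)).exists_forall_le'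
    hcont (a := 0) fun p hp => by
      have hne : p.2 ≠ 0 := by
        intro h0
        simpa [h0] using hp.2
      simpa using (hpos p.1 hp.1).dotProduct_mulVec_pos hne
  refine ⟨a / ((n : ℝ) ^ 2 + 1), by positivity, fun s hs B hB hBX => ?_⟩
  refine PosDef.of_dotProduct_mulVec_pos (by simpa [IsHermitian, IsSymm] using hB) fun v hv => ?_
  have hv' : 0 < ‖v‖ := norm_pos_iff.mpr hv
  set x : Fin n → ℝ := ‖v‖⁻¹ • v with hx
  have hx1 : ‖x‖ = 1 := by rw [hx, norm_smul, norm_inv, norm_norm, inv_mul_cancel₀ hv'.ne']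
  have hvx : v = ‖v‖ • x := by rw [hx, smul_smul, mul_inv_cancel₀ hv'.ne', one_smul]
  have h1 : a ≤ x ⬝ᵥ (X s *ᵥ x) := hle (s, x) ⟨hs, by simp [hx1]⟩
  have h2 := neg_le_dotProduct_mulVec (B - X s) x hx1.le
  rw [sub_mulVec, dotProduct_sub] at h2
  rw [lt_div_iff₀ (by positivity)] at hBX
  have h3 : 0 < x ⬝ᵥ (B *ᵥ x) := by linarith [frobNorm_nonneg (B - X s)]
  have h4 : star v ⬝ᵥ (B *ᵥ v) = ‖v‖ ^ 2 * (x ⬝ᵥ (B *ᵥ x)) := by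
    rw [star_trivial]
    conv_lhs => rw [hvx]
    rw [mulVec_smul, smul_dotProduct, dotProduct_smul, smul_eq_mul, smul_eq_mul]
    ring
  rw [h4]
  positivity

lemma exists_mem_Icc_succ {t : ℕ → ℝ} {s : ℝ} (h0 : t 0 ≤ s) :
    ∀ {m : ℕ}, 0 < m → s ≤ t m → ∃ k < m, s ∈ Icc (t k) (t (k + 1))
  | m + 1, _, hs => by
    rcases le_or_gt (t m) s with h | h
    · exact ⟨m, m.lt_succ_self, h, hs⟩
    · obtain rfl | hm := Nat.eq_zero_or_pos m
      · exact absurd h0 (not_le.mpr h)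
      · obtain ⟨k, hk, hks⟩ := exists_mem_Icc_succ h0 hm h.le
        exact ⟨k, hk.trans m.lt_succ_self, hks⟩

lemma le_of_forall_lt_succ {t : ℕ → ℝ} {M : ℕ} (ht : ∀ k < M, t k < t (k + 1)) {i j : ℕ}
    (hij : i ≤ j) (hj : j ≤ M) : t i ≤ t j := by
  induction j, hij using Nat.le_induction with
  | base => exact le_rfl
  | succ j _ ih => exact (ih (by omega)).trans (ht j hj).le

/-- A continuous piecewise-affine function is a sum of an affine function and ramps. -/
lemma piecewise_affine_eq_sum_ramps {E : Type*} [AddCommGroup E] [Module ℝ E]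
    {N : ℕ} {t : ℕ → ℝ} (ht : ∀ k < N + 1, t k < t (k + 1)) {A B : ℕ → E} {X : ℝ → E}
    (hX : ∀ k < N + 1, ∀ s ∈ Icc (t k) (t (k + 1)), X s = A k + s • B k)
    {s : ℝ} (hs : s ∈ Icc (t 0) (t (N + 1))) :
    X s = A 0 + s • B 0 +
      ∑ k ∈ Finset.range N, max (s - t (k + 1)) 0 • (B (k + 1) - B k) := by
  have key : ∀ k < N + 1, A k + s • B k =
      A 0 + s • B 0 + ∑ j ∈ Finset.range k, (s - t (j + 1)) • (B (j + 1) - B j) := by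
    intro k
    induction k with
    | zero => simp
    | succ k ih =>
      intro hk
      have h1 := hX k (by omega) (t (k + 1)) ⟨(ht k (by omega)).le, le_rfl⟩
      rw [hX (k + 1) hk (t (k + 1)) ⟨le_rfl, (ht (k + 1) hk).le⟩] at h1
      rw [Finset.sum_range_succ, ← add_assoc, ← ih (by omega)]
      have h2 : A (k + 1) = A k + t (k + 1) • B k - t (k + 1) • B (k + 1) :=
        eq_sub_of_add_eq h1
      rw [h2]
      module
  obtain ⟨k, hk, hks⟩ := exists_mem_Icc_succ hs.1 N.succ_pos hs.2
  rw [hX k hk s hks, key k hk]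
  congr 1
  rw [← Finset.sum_subset (Finset.range_mono (by omega : k ≤ N))]
  · refine Finset.sum_congr rfl fun j hj => ?_
    have hj' := Finset.mem_range.mp hj
    rw [max_eq_left (sub_nonneg.mpr ((le_of_forall_lt_succ ht hj' hk.le).trans hks.1))]
  · intro j hj hjk
    rw [Finset.mem_range] at hj hjk
    rw [max_eq_right, zero_smul]
    exact sub_nonpos.mpr (hks.2.trans (le_of_forall_lt_succ ht (by omega) (by omega)))

lemma isSymm_sum_smul {n : ℕ} {ι : Type*} (s : Finset ι) (w : ι → ℝ)
    {A : ι → Matrix (Fin n) (Fin n) ℝ} (hA : ∀ i ∈ s, (A i).IsSymm) :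
    (∑ i ∈ s, w i • A i).IsSymm := by
  rw [IsSymm, transpose_sum]
  exact Finset.sum_congr rfl fun i hi => (hA i hi).smul (w i)

lemma isSymm_slope {n : ℕ} {a b : ℝ} (hab : a < b) {A B : Matrix (Fin n) (Fin n) ℝ}
    (ha : (A + a • B).IsSymm) (hb : (A + b • B).IsSymm) : B.IsSymm := by
  have h : B = (b - a)⁻¹ • ((A + b • B) - (A + a • B)) := by
    rw [add_sub_add_left_eq_sub, ← sub_smul, smul_smul, inv_mul_cancel₀ (sub_pos.mpr hab).ne',
      one_smul]
  rw [h]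
  exact (hb.sub ha).smul _

/-- **Smoothing of continuous piecewise-affine matrix functions (STATEMENT 13,
cf. Lemma 6 of Stilwell–Rugh).** A continuous piecewise-affine symmetric
positive definite matrix function `X` on a compact interval `Γ = [ρmin, ρmax]`
(affine, `X(ρ) = M₀ₖ + ρM₁ₖ`, on each subinterval `[t k, t (k+1)]`, with corner
set `Γ̄ = {t k : 0 < k < M}`) admits, for every `ε > 0`, a continuously
differentiable symmetric approximation `Y` which (1) is `ε`-close to `X` within
distance `β` of the corners, (2) coincides with `X` at distance ≥ `β` from all
corners, (3) has derivative bounded by the maximal slope of `X`, and which is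
positive definite provided `ε` is small enough. -/
theorem piecewise_affine_smoothing
    (n : ℕ) (ρmin ρmax : ℝ) (hΓ : ρmin < ρmax)
    (M : ℕ) (hM : 0 < M) (t : ℕ → ℝ)
    (ht0 : t 0 = ρmin) (htM : t M = ρmax)
    (htmono : ∀ k < M, t k < t (k + 1))
    (M0 M1 : ℕ → Matrix (Fin n) (Fin n) ℝ)
    (X : ℝ → Matrix (Fin n) (Fin n) ℝ)
    (hXaff : ∀ k < M, ∀ s ∈ Icc (t k) (t (k + 1)), X s = M0 k + s • M1 k)
    (hXsymm : ∀ s ∈ Icc ρmin ρmax, (X s).IsSymm)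
    (hXpos : ∀ s ∈ Icc ρmin ρmax, (X s).PosDef) :
    ∃ ε₀ > (0:ℝ), ∀ ε > (0:ℝ), ∃ β > (0:ℝ),
      ∃ Y Y' : ℝ → Matrix (Fin n) (Fin n) ℝ,
        -- Y is continuously differentiable on Γ with derivative Y'
        (∀ s ∈ Icc ρmin ρmax, ∀ p q : Fin n,
          HasDerivAt (fun σ => Y σ p q) (Y' s p q) s) ∧
        ContinuousOn Y' (Icc ρmin ρmax) ∧
        -- Y is symmetric
        (∀ s ∈ Icc ρmin ρmax, (Y s).IsSymm) ∧
        -- (1) ε-closeness near the corner points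
        (∀ s ∈ Icc ρmin ρmax,
          (∃ k, 0 < k ∧ k < M ∧ |s - t k| < β) → frobNorm (Y s - X s) < ε) ∧
        -- (2) Y = X away from the corner points
        (∀ s ∈ Icc ρmin ρmax,
          (∀ k, 0 < k → k < M → β ≤ |s - t k|) → Y s = X s) ∧
        -- (3) the slope bound
        (∀ s ∈ Icc ρmin ρmax,
          frobNorm (Y' s)
            ≤ (Finset.range M).sup' (Finset.nonempty_range_iff.mpr hM.ne')
                (fun k => frobNorm (M1 k))) ∧
        -- for ε small enough, Y is positive definite
        (ε < ε₀ → ∀ s ∈ Icc ρmin ρmax, (Y s).PosDef) := by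
  obtain ⟨N, rfl⟩ : ∃ N, M = N + 1 := ⟨M - 1, by omega⟩
  subst ht0 htM
  have hnode : ∀ k ≤ N + 1, t k ∈ Icc (t 0) (t (N + 1)) := fun k hk =>
    ⟨le_of_forall_lt_succ htmono k.zero_le hk, le_of_forall_lt_succ htmono hk le_rfl⟩
  have hslope : ∀ k < N + 1, (M1 k).IsSymm := by
    intro k hk
    have hlt := htmono k hk
    refine isSymm_slope hlt (A := M0 k) ?_ ?_
    · rw [← hXaff k hk _ ⟨le_rfl, hlt.le⟩]
      exact hXsymm _ (hnode k hk.le)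
    · rw [← hXaff k hk _ ⟨hlt.le, le_rfl⟩]
      exact hXsymm _ (hnode (k + 1) hk)
  have hM0 : (M0 0).IsSymm := by
    have hlt := htmono 0 hM
    have h : M0 0 = X (t 0) - t 0 • M1 0 := by
      rw [hXaff 0 hM _ ⟨le_rfl, hlt.le⟩, add_sub_cancel_right]
    rw [h]
    exact (hXsymm _ (hnode 0 hM.le)).sub ((hslope 0 hM).smul _)
  set D : ℕ → Matrix (Fin n) (Fin n) ℝ := fun k => M1 (k + 1) - M1 k with hD
  have hXeq : ∀ s ∈ Icc (t 0) (t (N + 1)), X s =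
      M0 0 + s • M1 0 + ∑ k ∈ Finset.range N, max (s - t (k + 1)) 0 • D k :=
    fun s hs => piecewise_affine_eq_sum_ramps htmono hXaff hs
  have hXcont : ContinuousOn X (Icc (t 0) (t (N + 1))) := by
    refine ContinuousOn.congr (Continuous.continuousOn ?_) hXeq
    fun_prop
  obtain ⟨ε₀, hε₀, hstable⟩ := exists_posDef_of_frobNorm_sub_lt isCompact_Icc hXcont hXpos
  refine ⟨ε₀, hε₀, fun ε hε => ?_⟩
  set S : ℝ := ∑ k ∈ Finset.range N, frobNorm (D k) with hS
  have hS0 : 0 ≤ S := Finset.sum_nonneg fun k _ => frobNorm_nonneg _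
  obtain ⟨β, hβ, hβε⟩ : ∃ β > 0, β * S < ε := by
    refine ⟨ε / (S + 1), by positivity, ?_⟩
    rw [div_mul_eq_mul_div, div_lt_iff₀ (by positivity)]
    nlinarith
  set Y : ℝ → Matrix (Fin n) (Fin n) ℝ := fun s =>
    M0 0 + s • M1 0 + ∑ k ∈ Finset.range N, smoothRamp β (s - t (k + 1)) • D k with hY
  have hYsymm : ∀ s, (Y s).IsSymm := fun s =>
    (hM0.add ((hslope 0 hM).smul s)).add <| isSymm_sum_smul _ _ fun k hk => by
      have hk' := Finset.mem_range.mp hk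
      exact (hslope (k + 1) (by omega)).sub (hslope k (by omega))
  have hclose : ∀ s ∈ Icc (t 0) (t (N + 1)), frobNorm (Y s - X s) < ε := by
    intro s hs
    have h : Y s - X s = ∑ k ∈ Finset.range N,
        (smoothRamp β (s - t (k + 1)) - max (s - t (k + 1)) 0) • D k := by
      rw [hXeq s hs, hY]
      simp only [sub_smul, Finset.sum_sub_distrib]
      abel
    rw [h]
    refine lt_of_le_of_lt ((frobNorm_sum_smul_le _ _ _).trans ?_) hβε
    rw [hS, Finset.mul_sum]
    exact Finset.sum_le_sum fun k _ =>
      mul_le_mul_of_nonneg_right (abs_smoothRamp_sub_le hβ _) (frobNorm_nonneg _)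
  refine ⟨β, hβ, Y,
    fun s => M1 0 + ∑ k ∈ Finset.range N, smoothStep β (s - t (k + 1)) • D k,
    ?_, ?_, fun s _ => hYsymm s, fun s hs _ => hclose s hs, ?_, ?_,
    fun hlt s hs => hstable s hs _ (hYsymm s) ((hclose s hs).trans hlt)⟩
  · intro s _ p q
    simp only [hY, Matrix.add_apply, Matrix.smul_apply, Matrix.sum_apply, smul_eq_mul]
    refine HasDerivAt.add ?_ (HasDerivAt.fun_sum fun k _ => ?_)
    · simpa using ((hasDerivAt_id s).mul_const (M1 0 p q)).const_add (M0 0 p q)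
    · exact ((hasDerivAt_smoothRamp β _).comp_sub_const s (t (k + 1))).mul_const (D k p q)
  · have := continuous_smoothStep β
    exact Continuous.continuousOn (by fun_prop)
  · intro s hs hfar
    rw [hXeq s hs, hY]
    refine congrArg _ (Finset.sum_congr rfl fun k hk => ?_)
    have hk' := Finset.mem_range.mp hk
    rw [smoothRamp_eq_of_le_abs hβ (hfar (k + 1) k.succ_pos (by omega))]
  · intro s _
    refine frobNorm_add_sum_smul_sub_le M1
      (fun k => if k = 0 then 1 else smoothStep β (s - t k)) (if_pos rfl) N ?_ ?_ _ ?_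
    · intro k hk
      rw [if_neg k.succ_ne_zero]
      split_ifs
      · exact smoothStep_le_one hβ _
      · exact smoothStep_mono hβ (sub_le_sub_left (htmono k (by omega)).le s)
    · split_ifs
      · exact zero_le_one
      · exact smoothStep_nonneg hβ _
    · exact fun k hk => Finset.le_sup' (fun k => frobNorm (M1 k)) (Finset.mem_range.mpr hk)
end
end
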